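/- arXiv:2112.15473 — 5 statements merged into one kernel-verified Lean document; each statement's English description precedes it below -/
import Mathlib

section
/- Let g : ℝⁿ → Matrix (Fin n) (Fin n) ℝ be C^∞ with g(x) symmetric and positive definite for every x, let f : ℝⁿ → ℝⁿ be a C^∞ diffeomorphism (smooth, bijective, with smooth inverse), and let φ : ℝⁿ → ℝ be C^∞. Then (f*g)(x) is symmetric and positive definite for every x, and the coordinate Laplace–Beltrami operator is diffeomorphism-equivariant: Δ_{f*g}(φ ∘ f)(x) = (Δ_g φ)(f(x)) for every x ∈ ℝⁿ. (This is the coordinate form of the equivariance Q_{f*g}(f*φ) = f*(Q_g φ) underlying the general covariance of the free scalar BV theory, Lemma: any diffeomorphism defines a cochain map between fibers of the bundle of free scalar field theories over the space of metrics.) -/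
open Matrix

/-- The `μ`-th coordinate partial derivative `∂_μ ψ (x) = fderiv ℝ ψ x (e_μ)`. -/
noncomputable def pd (n : ℕ) (μ : Fin n) (ψ : (Fin n → ℝ) → ℝ) (x : Fin n → ℝ) : ℝ :=
  fderiv ℝ ψ x (Pi.single μ 1)

/-- The coordinate Laplace–Beltrami operator
`Δ_g φ (x) = (det g x)^(-1/2) ∑_μ ∂_μ ( y ↦ (det g y)^(1/2) ∑_ν (g y)⁻¹ μ ν ∂_ν φ y ) x`. -/
noncomputable def lapBel (n : ℕ) (g : (Fin n → ℝ) → Matrix (Fin n) (Fin n) ℝ)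
    (φ : (Fin n → ℝ) → ℝ) (x : Fin n → ℝ) : ℝ :=
  (Real.sqrt (g x).det)⁻¹ *
    ∑ μ, pd n μ (fun y => Real.sqrt (g y).det * ∑ ν, (g y)⁻¹ μ ν * pd n ν φ y) x

/-- The Jacobian matrix of `f` at `x`: the matrix of `fderiv ℝ f x` in the standard basis. -/
noncomputable def jacobian (n : ℕ) (f : (Fin n → ℝ) → (Fin n → ℝ)) (x : Fin n → ℝ) :
    Matrix (Fin n) (Fin n) ℝ :=
  Matrix.of fun i j => fderiv ℝ f x (Pi.single j 1) i

/-- The pullback metric `(f*g)(x) = (Df x)ᵀ * g (f x) * Df x`. -/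
noncomputable def pullbackMet (n : ℕ) (f : (Fin n → ℝ) → (Fin n → ℝ))
    (g : (Fin n → ℝ) → Matrix (Fin n) (Fin n) ℝ) (x : Fin n → ℝ) :
    Matrix (Fin n) (Fin n) ℝ :=
  (jacobian n f x)ᵀ * g (f x) * jacobian n f x

theorem aux_pd_mul (n : ℕ) (μ : Fin n) (a b : (Fin n → ℝ) → ℝ) (x : Fin n → ℝ)
    (ha : DifferentiableAt ℝ a x) (hb : DifferentiableAt ℝ b x) :
    pd n μ (fun y => a y * b y) x = pd n μ a x * b x + a x * pd n μ b x := by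
  unfold pd
  rw [fderiv_fun_mul ha hb]
  simp
  ring

theorem aux_pd_sum (n : ℕ) (μ : Fin n) (a : Fin n → (Fin n → ℝ) → ℝ) (x : Fin n → ℝ)
    (ha : ∀ i, DifferentiableAt ℝ (a i) x) :
    pd n μ (fun y => ∑ i, a i y) x = ∑ i, pd n μ (a i) x := by
  unfold pd
  rw [fderiv_fun_sum (fun i _ => ha i)]
  simp

theorem aux_pd_comp (n : ℕ) (μ : Fin n) (ψ : (Fin n → ℝ) → ℝ) (f : (Fin n → ℝ) → (Fin n → ℝ))
    (x : Fin n → ℝ) (hψ : DifferentiableAt ℝ ψ (f x)) (hf : DifferentiableAt ℝ f x) :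
    pd n μ (fun y => ψ (f y)) x = ∑ b, pd n b ψ (f x) * jacobian n f x b μ := by
  unfold pd jacobian
  have h : fderiv ℝ (fun y => ψ (f y)) x = (fderiv ℝ ψ (f x)).comp (fderiv ℝ f x) :=
    fderiv_comp x hψ hf
  rw [h]
  have := LinearMap.pi_apply_eq_sum_univ (fderiv ℝ ψ (f x)).toLinearMap
    (fderiv ℝ f x (Pi.single μ 1))
  simp only [ContinuousLinearMap.coe_coe, smul_eq_mul] at this
  simp only [ContinuousLinearMap.comp_apply, Matrix.of_apply]
  rw [this]
  refine Finset.sum_congr rfl fun b _ => ?_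
  rw [mul_comm]
  congr 2
  ext j
  simp [Pi.single_apply, eq_comm]

noncomputable def auxDet (n : ℕ) : ContinuousMultilinearMap ℝ (fun _ : Fin n => (Fin n → ℝ)) ℝ :=
  { (Matrix.detRowAlternating (n := Fin n) (R := ℝ)).toMultilinearMap with
    cont := by
      show Continuous fun M : Matrix (Fin n) (Fin n) ℝ => M.det
      exact continuous_id.matrix_det }

theorem auxDet_apply (n : ℕ) (M : Matrix (Fin n) (Fin n) ℝ) : auxDet n M = M.det := rfl

theorem aux_hasFDerivAt_det (n : ℕ) (M : (Fin n → ℝ) → Matrix (Fin n) (Fin n) ℝ) (x : Fin n → ℝ)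
    (hM : ∀ i j, DifferentiableAt ℝ (fun y => M y i j) x) :
    HasFDerivAt (fun y => (M y).det)
      (((auxDet n).linearDeriv (M x)).comp (ContinuousLinearMap.pi fun i =>
        ContinuousLinearMap.pi fun j => fderiv ℝ (fun y => M y i j) x)) x := by
  have h2 : HasFDerivAt (fun y => (fun i j => M y i j : Fin n → Fin n → ℝ))
      (ContinuousLinearMap.pi fun i =>
        ContinuousLinearMap.pi fun j => fderiv ℝ (fun y => M y i j) x) x :=
    hasFDerivAt_pi.2 fun i => hasFDerivAt_pi.2 fun j => (hM i j).hasFDerivAt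
  exact ((auxDet n).hasFDerivAt (M x)).comp x h2

theorem aux_det_diff (n : ℕ) (M : (Fin n → ℝ) → Matrix (Fin n) (Fin n) ℝ) (x : Fin n → ℝ)
    (hM : ∀ i j, DifferentiableAt ℝ (fun y => M y i j) x) :
    DifferentiableAt ℝ (fun y => (M y).det) x :=
  (aux_hasFDerivAt_det n M x hM).differentiableAt

theorem aux_pd_det (n : ℕ) (μ : Fin n) (M : (Fin n → ℝ) → Matrix (Fin n) (Fin n) ℝ)
    (x : Fin n → ℝ) (hM : ∀ i j, DifferentiableAt ℝ (fun y => M y i j) x) :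
    pd n μ (fun y => (M y).det) x
      = ∑ i, ∑ j, (M x).adjugate j i * pd n μ (fun y => M y i j) x := by
  unfold pd
  rw [(aux_hasFDerivAt_det n M x hM).fderiv]
  rw [ContinuousLinearMap.comp_apply]
  refine ((auxDet n).linearDeriv_apply (M x) _).trans ?_
  refine Finset.sum_congr rfl fun i _ => ?_
  have := cramer_transpose_apply (M x) (fun j => fderiv ℝ (fun y => M y i j) x (Pi.single μ 1)) i
  rw [cramer_eq_adjugate_mulVec, ← adjugate_transpose] at this
  simp only [mulVec, dotProduct, transpose_apply] at this
  rw [this]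
  rfl

theorem aux_inv_diff (n : ℕ) (M : (Fin n → ℝ) → Matrix (Fin n) (Fin n) ℝ) (x : Fin n → ℝ)
    (hM : ∀ i j, DifferentiableAt ℝ (fun y => M y i j) x) (h0 : (M x).det ≠ 0) (i j : Fin n) :
    DifferentiableAt ℝ (fun y => (M y)⁻¹ i j) x := by
  have : (fun y => (M y)⁻¹ i j) =
      fun y => (M y).det⁻¹ * ((M y).updateRow j (Pi.single i 1)).det := by
    funext y
    rw [Matrix.inv_def, Matrix.smul_apply, adjugate_apply]
    simp
  rw [this]
  refine DifferentiableAt.mul (DifferentiableAt.inv (aux_det_diff n M x hM) h0)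
    (aux_det_diff n _ x ?_)
  intro a b
  by_cases h : a = j
  · subst h
    simp
  · simpa [updateRow_ne h] using hM a b

theorem aux_pd_inv (n : ℕ) (μ : Fin n) (M : (Fin n → ℝ) → Matrix (Fin n) (Fin n) ℝ)
    (x : Fin n → ℝ) (hM : ∀ i j, DifferentiableAt ℝ (fun y => M y i j) x)
    (h0 : ∀ y, (M y).det ≠ 0) (i j : Fin n) :
    pd n μ (fun y => (M y)⁻¹ i j) x
      = - ∑ b, ∑ c, (M x)⁻¹ i b * pd n μ (fun y => M y b c) x * (M x)⁻¹ c j := by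
  have hu : ∀ y, IsUnit (M y).det := fun y => (h0 y).isUnit
  set P : Matrix (Fin n) (Fin n) ℝ := Matrix.of fun i j => pd n μ (fun y => (M y)⁻¹ i j) x with hP
  set Q : Matrix (Fin n) (Fin n) ℝ := Matrix.of fun i j => pd n μ (fun y => M y i j) x with hQ
  have key : P * M x + (M x)⁻¹ * Q = 0 := by
    ext a b
    have h1 : (fun y => ∑ k, (M y)⁻¹ a k * M y k b) =
        fun _ => (1 : Matrix (Fin n) (Fin n) ℝ) a b := by
      funext y
      rw [← Matrix.nonsing_inv_mul _ (hu y), Matrix.mul_apply]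
    have h2 := aux_pd_sum n μ (fun k y => (M y)⁻¹ a k * M y k b) x
      (fun k => (aux_inv_diff n M x hM (h0 x) a k).mul (hM k b))
    rw [h1] at h2
    have h3 : ∀ k, pd n μ (fun y => (M y)⁻¹ a k * M y k b) x = _ := fun k =>
      aux_pd_mul n μ _ _ x (aux_inv_diff n M x hM (h0 x) a k) (hM k b)
    simp only [h3, Finset.sum_add_distrib] at h2
    simp only [Matrix.add_apply, Matrix.mul_apply, hP, hQ, Matrix.of_apply, Matrix.zero_apply]
    rw [← h2]
    simp [pd]
  have : P = - ((M x)⁻¹ * Q * (M x)⁻¹) := by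
    have h4 : P * M x = - ((M x)⁻¹ * Q) := eq_neg_of_add_eq_zero_left key
    calc P = P * M x * (M x)⁻¹ := by
          rw [Matrix.mul_assoc, Matrix.mul_nonsing_inv _ (hu x), Matrix.mul_one]
      _ = _ := by rw [h4, Matrix.neg_mul]
  have h5 := congrFun (congrFun this i) j
  simp only [hP, hQ, Matrix.of_apply, Matrix.neg_apply, Matrix.mul_apply, Finset.sum_mul] at h5
  rw [h5, Finset.sum_comm]

theorem aux_jac_diff (n : ℕ) (f : (Fin n → ℝ) → (Fin n → ℝ)) (hf : ContDiff ℝ (⊤ : ℕ∞) f)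
    (x : Fin n → ℝ) (i j : Fin n) : DifferentiableAt ℝ (fun y => jacobian n f y i j) x := by
  have h1 : ContDiff ℝ 1 (fderiv ℝ f) := hf.fderiv_right (by norm_cast)
  have h2 : DifferentiableAt ℝ (fderiv ℝ f) x := h1.differentiable (by simp) x
  have h3 : DifferentiableAt ℝ (fun y => fderiv ℝ f y (Pi.single j 1)) x :=
    h2.clm_apply (differentiableAt_const _)
  exact differentiableAt_pi.1 h3 i

theorem aux_jac_symm (n : ℕ) (f : (Fin n → ℝ) → (Fin n → ℝ)) (hf : ContDiff ℝ (⊤ : ℕ∞) f)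
    (x : Fin n → ℝ) (i j k : Fin n) :
    pd n k (fun y => jacobian n f y i j) x = pd n j (fun y => jacobian n f y i k) x := by
  have h1 : ContDiff ℝ 1 (fderiv ℝ f) := hf.fderiv_right (by norm_cast)
  have h2 : DifferentiableAt ℝ (fderiv ℝ f) x := h1.differentiable (by simp) x
  have hs : IsSymmSndFDerivAt ℝ f x :=
    hf.contDiffAt.isSymmSndFDerivAt (by simp; norm_cast)
  have key : ∀ j k, pd n k (fun y => jacobian n f y i j) x =
      fderiv ℝ (fderiv ℝ f) x (Pi.single k 1) (Pi.single j 1) i := by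
    intro j k
    have h3 := (h2.hasFDerivAt.clm_apply
      (hasFDerivAt_const (Pi.single j 1 : Fin n → ℝ) x))
    have h4 := (hasFDerivAt_pi'.1 h3 i).fderiv
    unfold pd jacobian
    simp only [Matrix.of_apply]
    rw [h4]
    simp
  rw [key, key, hs.eq]

theorem aux_piola (n : ℕ) (f : (Fin n → ℝ) → (Fin n → ℝ)) (hf : ContDiff ℝ (⊤ : ℕ∞) f)
    (h0 : ∀ y, (jacobian n f y).det ≠ 0) (x : Fin n → ℝ) (a : Fin n) :
    ∑ μ, pd n μ (fun y => (jacobian n f y).det * (jacobian n f y)⁻¹ μ a) x = 0 := by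
  have hJ := aux_jac_diff n f hf x
  have hu : IsUnit (jacobian n f x).det := (h0 x).isUnit
  have hadj : ∀ i j, (jacobian n f x).adjugate i j =
      (jacobian n f x).det * (jacobian n f x)⁻¹ i j := by
    intro i j
    rw [Matrix.inv_def, Matrix.smul_apply, Ring.inverse_eq_inv', smul_eq_mul,
      mul_inv_cancel_left₀ (h0 x)]
  have h1 : ∀ μ, pd n μ (fun y => (jacobian n f y).det * (jacobian n f y)⁻¹ μ a) x = _ := fun μ =>
    aux_pd_mul n μ _ _ x (aux_det_diff n _ x hJ) (aux_inv_diff n _ x hJ (h0 x) μ a)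
  simp only [h1, aux_pd_det n _ _ x hJ, aux_pd_inv n _ _ x hJ h0, hadj]
  rw [Finset.sum_add_distrib]
  simp only [mul_neg, Finset.sum_neg_distrib, ← sub_eq_add_neg]
  rw [sub_eq_zero]
  simp only [Finset.sum_mul, Finset.mul_sum]
  -- both sides are triple sums
  have hL : ∀ μ i j : Fin n, (jacobian n f x).det * (jacobian n f x)⁻¹ j i *
      pd n μ (fun y => jacobian n f y i j) x * (jacobian n f x)⁻¹ μ a =
      (jacobian n f x).det * ((jacobian n f x)⁻¹ j i *
        pd n j (fun y => jacobian n f y i μ) x * (jacobian n f x)⁻¹ μ a) := by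
    intro μ i j
    rw [aux_jac_symm n f hf x i j μ]
    ring
  simp only [hL]
  rw [Finset.sum_comm]
  conv_rhs => rw [Finset.sum_comm]
  refine Finset.sum_congr rfl fun i _ => ?_
  rw [Finset.sum_comm]

theorem aux_div (n : ℕ) (f : (Fin n → ℝ) → (Fin n → ℝ)) (hf : ContDiff ℝ (⊤ : ℕ∞) f)
    (h0 : ∀ y, (jacobian n f y).det ≠ 0) (x : Fin n → ℝ)
    (V : Fin n → (Fin n → ℝ) → ℝ) (hV : ∀ a y, DifferentiableAt ℝ (V a) y) :
    ∑ μ, pd n μ (fun y => ∑ a, ((jacobian n f y).det * (jacobian n f y)⁻¹ μ a) * V a (f y)) x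
      = (jacobian n f x).det * ∑ a, pd n a (V a) (f x) := by
  have hJ := aux_jac_diff n f hf x
  have hu : IsUnit (jacobian n f x).det := (h0 x).isUnit
  have hfd : DifferentiableAt ℝ f x := hf.differentiable (by simp) x
  have hA : ∀ μ a, DifferentiableAt ℝ
      (fun y => (jacobian n f y).det * (jacobian n f y)⁻¹ μ a) x := fun μ a =>
    (aux_det_diff n _ x hJ).mul (aux_inv_diff n _ x hJ (h0 x) μ a)
  have hVf : ∀ a, DifferentiableAt ℝ (fun y => V a (f y)) x := fun a =>
    (hV a (f x)).comp x hfd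
  have h1 : ∀ μ, pd n μ (fun y => ∑ a, ((jacobian n f y).det * (jacobian n f y)⁻¹ μ a) *
      V a (f y)) x = _ := fun μ => aux_pd_sum n μ _ x (fun a => (hA μ a).mul (hVf a))
  have h2 : ∀ μ a, pd n μ (fun y => ((jacobian n f y).det * (jacobian n f y)⁻¹ μ a) *
      V a (f y)) x = _ := fun μ a => aux_pd_mul n μ _ _ x (hA μ a) (hVf a)
  simp only [h1, h2]
  rw [Finset.sum_comm, Finset.mul_sum]
  refine Finset.sum_congr rfl fun a _ => ?_
  rw [Finset.sum_add_distrib, ← Finset.sum_mul, aux_piola n f hf h0 x a, zero_mul, zero_add]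
  have h3 : ∀ μ, pd n μ (fun y => V a (f y)) x = _ := fun μ =>
    aux_pd_comp n μ (V a) f x (hV a _) hfd
  simp only [h3, Finset.mul_sum]
  rw [Finset.sum_comm]
  have h4 : ∀ b, ∑ μ, (jacobian n f x).det * (jacobian n f x)⁻¹ μ a *
      (pd n b (V a) (f x) * jacobian n f x b μ) =
      (jacobian n f x).det * pd n b (V a) (f x) * (1 : Matrix (Fin n) (Fin n) ℝ) b a := by
    intro b
    rw [← Matrix.mul_nonsing_inv _ hu, Matrix.mul_apply, Finset.mul_sum]
    refine Finset.sum_congr rfl fun μ _ => ?_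
    ring
  simp [h4, Matrix.one_apply]

theorem aux_jac_isUnit (n : ℕ) (f f_inv : (Fin n → ℝ) → (Fin n → ℝ))
    (hf : ContDiff ℝ (⊤ : ℕ∞) f) (hf_inv : ContDiff ℝ (⊤ : ℕ∞) f_inv)
    (hleft : Function.LeftInverse f_inv f) (x : Fin n → ℝ) :
    jacobian n f_inv (f x) * jacobian n f x = 1 := by
  have hfd : DifferentiableAt ℝ f x := hf.differentiable (by simp) x
  have hid : DifferentiableAt ℝ f_inv (f x) := hf_inv.differentiable (by simp) _
  ext i j
  have h1 := aux_pd_comp n j (fun z => f_inv z i) f x (differentiableAt_pi.1 hid i) hfd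
  have h2 : (fun y => f_inv (f y) i) = fun y => y i := by
    funext y
    rw [hleft y]
  simp only [h2] at h1
  have h3 : ∀ b, pd n b (fun z => f_inv z i) (f x) = jacobian n f_inv (f x) i b := by
    intro b
    unfold pd jacobian
    rw [(hasFDerivAt_pi'.1 hid.hasFDerivAt i).fderiv]
    rfl
  simp only [h3] at h1
  rw [Matrix.mul_apply, ← h1]
  unfold pd
  rw [(hasFDerivAt_apply i x).fderiv]
  simp [Matrix.one_apply, Pi.single_apply]

/-- `f*g` is again symmetric positive definite, and the Laplace–Beltrami operator is
diffeomorphism-equivariant: `Δ_{f*g}(φ ∘ f) = (Δ_g φ) ∘ f`. -/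
theorem laplace_beltrami_equivariant (n : ℕ)
    (g : (Fin n → ℝ) → Matrix (Fin n) (Fin n) ℝ)
    (hg : ∀ i j, ContDiff ℝ (⊤ : ℕ∞) fun x => g x i j)
    (hsymm : ∀ x, (g x).IsSymm) (hpos : ∀ x, (g x).PosDef)
    (f f_inv : (Fin n → ℝ) → (Fin n → ℝ))
    (hf : ContDiff ℝ (⊤ : ℕ∞) f) (hf_inv : ContDiff ℝ (⊤ : ℕ∞) f_inv)
    (hleft : Function.LeftInverse f_inv f) (hright : Function.RightInverse f_inv f)
    (φ : (Fin n → ℝ) → ℝ) (hφ : ContDiff ℝ (⊤ : ℕ∞) φ) :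
    (∀ x, (pullbackMet n f g x).IsSymm ∧ (pullbackMet n f g x).PosDef) ∧
      (∀ x, lapBel n (pullbackMet n f g) (φ ∘ f) x = lapBel n g φ (f x)) := by
  have hmul := aux_jac_isUnit n f f_inv hf hf_inv hleft
  have h0 : ∀ y, (jacobian n f y).det ≠ 0 := by
    intro y h
    have := congrArg Matrix.det (hmul y)
    rw [Matrix.det_mul, h, mul_zero, Matrix.det_one] at this
    exact zero_ne_one this
  have hu : ∀ y, IsUnit (jacobian n f y).det := fun y => (h0 y).isUnit
  refine ⟨fun x => ⟨?_, ?_⟩, fun x => ?_⟩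
  · unfold pullbackMet
    rw [Matrix.IsSymm, Matrix.transpose_mul, Matrix.transpose_mul, Matrix.transpose_transpose,
      (hsymm (f x)).eq, Matrix.mul_assoc]
  · unfold pullbackMet
    rw [← Matrix.conjTranspose_eq_transpose_of_trivial]
    exact (hpos (f x)).conjTranspose_mul_mul_same
      (Matrix.mulVec_injective_of_isUnit ((Matrix.isUnit_iff_isUnit_det _).2 (hu x)))
  have hgd : ∀ y i j, DifferentiableAt ℝ (fun z => g z i j) y := fun y i j =>
    (hg i j).differentiable (by simp) y
  have hgpos : ∀ y, 0 < (g y).det := fun y => (hpos y).det_pos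
  have hφd : ∀ y, DifferentiableAt ℝ φ y := fun y => hφ.differentiable (by simp) y
  have hfd : ∀ y, DifferentiableAt ℝ f y := fun y => hf.differentiable (by simp) y
  have hpφ : ∀ ν y, DifferentiableAt ℝ (pd n ν φ) y := by
    intro ν y
    have h1 : ContDiff ℝ 1 (fderiv ℝ φ) := hφ.fderiv_right (by norm_cast)
    have h2 : DifferentiableAt ℝ (fderiv ℝ φ) y := h1.differentiable (by simp) y
    exact h2.clm_apply (differentiableAt_const _)
  let V : Fin n → (Fin n → ℝ) → ℝ := fun a y =>
    Real.sqrt (g y).det * ∑ ν, (g y)⁻¹ a ν * pd n ν φ y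
  have hV : ∀ a y, DifferentiableAt ℝ (V a) y := by
    intro a y
    refine ((aux_det_diff n g y (hgd y)).sqrt (hgpos y).ne').mul ?_
    refine DifferentiableAt.fun_sum fun ν _ => ?_
    exact (aux_inv_diff n g y (hgd y) (hgpos y).ne' a ν).mul (hpφ ν y)
  have hsq : ∀ y, Real.sqrt (pullbackMet n f g y).det =
      |(jacobian n f y).det| * Real.sqrt (g (f y)).det := by
    intro y
    unfold pullbackMet
    rw [Matrix.det_mul, Matrix.det_mul, Matrix.det_transpose,
      show (jacobian n f y).det * (g (f y)).det * (jacobian n f y).det =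
        (jacobian n f y).det ^ 2 * (g (f y)).det by ring,
      Real.sqrt_mul (sq_nonneg _), Real.sqrt_sq_eq_abs]
  have hgrad : ∀ y ν, pd n ν (φ ∘ f) y = ((jacobian n f y)ᵀ *ᵥ fun b => pd n b φ (f y)) ν := by
    intro y ν
    rw [show (φ ∘ f) = fun z => φ (f z) from rfl, aux_pd_comp n ν φ f y (hφd _) (hfd y)]
    simp only [mulVec, dotProduct, transpose_apply]
    exact Finset.sum_congr rfl fun b _ => mul_comm _ _
  have hflux : ∀ μ y, Real.sqrt (pullbackMet n f g y).det *
      ∑ ν, (pullbackMet n f g y)⁻¹ μ ν * pd n ν (φ ∘ f) y =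
      |(jacobian n f y).det| * ∑ a, (jacobian n f y)⁻¹ μ a * V a (f y) := by
    intro μ y
    have hv : (pullbackMet n f g y)⁻¹ *ᵥ ((jacobian n f y)ᵀ *ᵥ fun b => pd n b φ (f y)) =
        (jacobian n f y)⁻¹ *ᵥ ((g (f y))⁻¹ *ᵥ fun b => pd n b φ (f y)) := by
      unfold pullbackMet
      rw [Matrix.mul_inv_rev, Matrix.mul_inv_rev, Matrix.mulVec_mulVec, Matrix.mulVec_mulVec]
      rw [Matrix.mul_assoc, Matrix.mul_assoc, Matrix.nonsing_inv_mul, Matrix.mul_one]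
      rw [Matrix.det_transpose]
      exact hu y
    have hv' := congrFun hv μ
    simp only [hgrad]
    rw [hsq, mul_assoc]
    congr 1
    rw [show ∑ ν, (pullbackMet n f g y)⁻¹ μ ν *
      ((jacobian n f y)ᵀ *ᵥ fun b => pd n b φ (f y)) ν =
      ((pullbackMet n f g y)⁻¹ *ᵥ ((jacobian n f y)ᵀ *ᵥ fun b => pd n b φ (f y))) μ from rfl, hv']
    simp only [V, mulVec, dotProduct]
    rw [Finset.mul_sum]
    exact Finset.sum_congr rfl fun a _ => by ring
  have hcont : ContinuousAt (fun y => (jacobian n f y).det) x :=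
    (aux_det_diff n _ x (aux_jac_diff n f hf x)).continuousAt
  obtain ⟨s, hs, hsx⟩ : ∃ s : ℝ, (∀ᶠ y in nhds x, |(jacobian n f y).det| =
      s * (jacobian n f y).det) ∧ s * (jacobian n f x).det = |(jacobian n f x).det| := by
    rcases lt_or_gt_of_ne (h0 x) with h | h
    · refine ⟨-1, ?_, by rw [abs_of_neg h]; ring⟩
      filter_upwards [hcont.eventually_lt continuousAt_const h] with y hy
      rw [abs_of_neg hy]; ring
    · refine ⟨1, ?_, by rw [abs_of_pos h]; ring⟩
      filter_upwards [continuousAt_const.eventually_lt hcont h] with y hy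
      rw [abs_of_pos hy]; ring
  have hVs : ∀ a y, DifferentiableAt ℝ (fun z => s * V a z) y := fun a y => (hV a y).const_mul s
  have hpd : ∀ μ, pd n μ (fun y => Real.sqrt (pullbackMet n f g y).det *
      ∑ ν, (pullbackMet n f g y)⁻¹ μ ν * pd n ν (φ ∘ f) y) x =
      pd n μ (fun y => ∑ a, ((jacobian n f y).det * (jacobian n f y)⁻¹ μ a) *
        (s * V a (f y))) x := by
    intro μ
    have : (fun y => Real.sqrt (pullbackMet n f g y).det *
      ∑ ν, (pullbackMet n f g y)⁻¹ μ ν * pd n ν (φ ∘ f) y) =ᶠ[nhds x]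
      (fun y => ∑ a, ((jacobian n f y).det * (jacobian n f y)⁻¹ μ a) *
        (s * V a (f y))) := by
      filter_upwards [hs] with y hy
      rw [hflux, hy, Finset.mul_sum]
      exact Finset.sum_congr rfl fun a _ => by ring
    unfold pd at this ⊢
    rw [this.fderiv_eq]
  have hdiv := aux_div n f hf h0 x (fun a z => s * V a z) hVs
  have hconst : ∀ a, pd n a (fun z => s * V a z) (f x) = s * pd n a (V a) (f x) := by
    intro a
    unfold pd
    rw [fderiv_const_mul (hV a _)]
    simp
  unfold lapBel
  simp only [hpd]
  rw [hdiv]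
  simp only [hconst]
  rw [← Finset.mul_sum, hsq, ← mul_assoc (jacobian n f x).det, mul_comm _ s, hsx]
  have habs : |(jacobian n f x).det| ≠ 0 := abs_ne_zero.2 (h0 x)
  rw [mul_inv, mul_assoc, mul_left_comm _ |(jacobian n f x).det|, inv_mul_cancel_left₀ habs]
end

section
/- Let g : ℝⁿ → Matrix (Fin n) (Fin n) ℝ be C^∞ with g(x) symmetric and positive definite for every x, let f : ℝⁿ → ℝⁿ be a C^∞ diffeomorphism, and let φ : ℝⁿ → ℝ be C^∞. Then for every x ∈ ℝⁿ, √(det((f*g)(x))) · Δ_{f*g}(φ ∘ f)(x) = |det Df(x)| · √(det g(f(x))) · (Δ_g φ)(f(x)). (This is the coordinate form of the density-valued equivariance f*(Δ_g φ · vol_g) = Δ_{f*g}(f*φ) · vol_{f*g}, i.e. the statement that the differential Q_g φ = Δ_g φ vol_g of the free scalar BV complex commutes with diffeomorphisms.) -/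
open Matrix

lemma lb_pd_mul {n : ℕ} (μ : Fin n) {u v : (Fin n → ℝ) → ℝ} {x : Fin n → ℝ}
    (hu : DifferentiableAt ℝ u x) (hv : DifferentiableAt ℝ v x) :
    pd n μ (fun y => u y * v y) x = pd n μ u x * v x + u x * pd n μ v x := by
  unfold pd
  rw [fderiv_fun_mul hu hv]
  simp
  ring

lemma lb_pd_sum {n : ℕ} (μ : Fin n) {ι : Type*} (s : Finset ι) {u : ι → (Fin n → ℝ) → ℝ}
    {x : Fin n → ℝ} (hu : ∀ i, DifferentiableAt ℝ (u i) x) :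
    pd n μ (fun y => ∑ i ∈ s, u i y) x = ∑ i ∈ s, pd n μ (u i) x := by
  unfold pd
  rw [fderiv_fun_sum (fun i _ => hu i)]
  simp

lemma lb_clm {n : ℕ} (L : (Fin n → ℝ) →L[ℝ] ℝ) (v : Fin n → ℝ) :
    L v = ∑ k, L (Pi.single k 1) * v k := by
  conv_lhs => rw [pi_eq_sum_univ' v]
  rw [map_sum]
  refine Finset.sum_congr rfl fun k _ => ?_
  rw [map_smul, smul_eq_mul, mul_comm]

lemma lb_pd_comp {n : ℕ} (μ : Fin n) {V : (Fin n → ℝ) → ℝ} {f : (Fin n → ℝ) → (Fin n → ℝ)}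
    {x : Fin n → ℝ} (hV : DifferentiableAt ℝ V (f x)) (hf : DifferentiableAt ℝ f x) :
    pd n μ (fun y => V (f y)) x = ∑ k, pd n k V (f x) * jacobian n f x k μ := by
  unfold pd jacobian
  have : (fun y => V (f y)) = V ∘ f := rfl
  rw [this, fderiv_comp x hV hf, ContinuousLinearMap.comp_apply, lb_clm]
  rfl

lemma lb_det_diff {n m : ℕ} {k : WithTop ℕ∞} {M : (Fin n → ℝ) → Matrix (Fin m) (Fin m) ℝ}
    (hM : ∀ i j, ContDiff ℝ k fun y => M y i j) : ContDiff ℝ k fun y => (M y).det := by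
  simp only [Matrix.det_apply']
  refine ContDiff.sum fun σ _ => contDiff_const.mul (contDiff_prod fun i _ => hM _ _)

lemma lb_prod {n m : ℕ} {u : Fin m → (Fin n → ℝ) → ℝ} {x : Fin n → ℝ}
    (hu : ∀ i, DifferentiableAt ℝ (u i) x) : DifferentiableAt ℝ (fun y => ∏ i, u i y) x :=
  (HasFDerivAt.finsetProd fun i _ => (hu i).hasFDerivAt).differentiableAt

lemma lb_jacobi {n : ℕ} (μ : Fin n) {M : (Fin n → ℝ) → Matrix (Fin n) (Fin n) ℝ} {x : Fin n → ℝ}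
    (hM : ∀ i j, DifferentiableAt ℝ (fun y => M y i j) x) :
    pd n μ (fun y => (M y).det) x =
      ∑ i, ∑ j, (M x).adjugate i j * pd n μ (fun y => M y j i) x := by
  have h1 : ∀ i, ∑ j, (M x).adjugate i j * pd n μ (fun y => M y j i) x =
      ((M x).updateCol i (fun j => pd n μ (fun y => M y j i) x)).det := by
    intro i
    rw [← Matrix.cramer_apply, Matrix.cramer_eq_adjugate_mulVec]
    rfl
  simp only [h1, Matrix.det_apply']
  rw [lb_pd_sum]
  · rw [Finset.sum_comm]
    refine Finset.sum_congr rfl fun σ _ => ?_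
    rw [lb_pd_mul μ (differentiableAt_const _)
      (lb_prod fun i => hM _ _)]
    have : pd n μ (fun _ => ((Equiv.Perm.sign σ : ℤ) : ℝ)) x = 0 := by simp [pd]
    rw [this, zero_mul, zero_add, ← Finset.mul_sum]
    congr 1
    unfold pd
    rw [fderiv_finsetProd (fun i _ => hM _ _)]
    rw [ContinuousLinearMap.sum_apply]
    refine Finset.sum_congr rfl fun i _ => ?_
    rw [← Finset.mul_prod_erase _ _ (Finset.mem_univ i)]
    simp only [Matrix.updateCol_self, ContinuousLinearMap.smul_apply, smul_eq_mul]
    rw [mul_comm]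
    congr 1
    refine Finset.prod_congr rfl fun j hj => ?_
    rw [Matrix.updateCol_ne (Finset.ne_of_mem_erase hj)]
  · intro σ
    exact (differentiableAt_const _).fun_mul (lb_prod fun i => hM _ _)

lemma lb_jac_smooth {n : ℕ} {f : (Fin n → ℝ) → (Fin n → ℝ)} (hf : ContDiff ℝ (⊤ : ℕ∞) f)
    (i j : Fin n) : ContDiff ℝ (⊤ : ℕ∞) fun y => jacobian n f y i j := by
  have h : ContDiff ℝ (⊤ : ℕ∞) (fderiv ℝ f) := hf.fderiv_right (by simp)
  have h2 := h.clm_apply (contDiff_const (c := (Pi.single j 1 : Fin n → ℝ)))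
  exact contDiff_pi.1 h2 i

lemma lb_pd_smooth {n : ℕ} {φ : (Fin n → ℝ) → ℝ} (hf : ContDiff ℝ (⊤ : ℕ∞) φ)
    (i : Fin n) : ContDiff ℝ (⊤ : ℕ∞) fun y => pd n i φ y := by
  have h : ContDiff ℝ (⊤ : ℕ∞) (fderiv ℝ φ) := hf.fderiv_right (by simp)
  exact h.clm_apply (contDiff_const (c := (Pi.single i 1 : Fin n → ℝ)))

lemma lb_symm {n : ℕ} {f : (Fin n → ℝ) → (Fin n → ℝ)} (hf : ContDiff ℝ (⊤ : ℕ∞) f)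
    (μ k l : Fin n) (x : Fin n → ℝ) :
    pd n μ (fun y => jacobian n f y k l) x = pd n l (fun y => jacobian n f y k μ) x := by
  have h : ContDiff ℝ (⊤ : ℕ∞) (fderiv ℝ f) := hf.fderiv_right (by simp)
  have hd : DifferentiableAt ℝ (fderiv ℝ f) x := (h.differentiable (by simp)) x
  have key : ∀ μ l, pd n μ (fun y => jacobian n f y k l) x =
      fderiv ℝ (fderiv ℝ f) x (Pi.single μ 1) (Pi.single l 1) k := by
    intro μ l
    unfold pd jacobian
    have h1 : HasFDerivAt (fun y => fderiv ℝ f y (Pi.single l 1) k)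
      ((ContinuousLinearMap.proj (R := ℝ) (φ := fun _ : Fin n => ℝ) k).comp
        ((ContinuousLinearMap.apply ℝ (Fin n → ℝ) (Pi.single l 1 : Fin n → ℝ)).comp
          (fderiv ℝ (fderiv ℝ f) x))) x :=
      ((ContinuousLinearMap.proj (R := ℝ) (φ := fun _ : Fin n => ℝ) k).comp
        (ContinuousLinearMap.apply ℝ (Fin n → ℝ)
          (Pi.single l 1 : Fin n → ℝ))).hasFDerivAt.comp x hd.hasFDerivAt
    simp only [Matrix.of_apply]
    rw [h1.fderiv]
    rfl
  rw [key, key]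
  have := (hf.contDiffAt (x := x)).isSymmSndFDerivAt (by
    rw [minSmoothness_of_isRCLikeNormedField]
    exact WithTop.coe_le_coe.2 le_top)
  rw [this.eq]

/-- The inverse Jacobian. -/
lemma lb_inv {n : ℕ} {f f_inv : (Fin n → ℝ) → (Fin n → ℝ)}
    (hf : ContDiff ℝ (⊤ : ℕ∞) f) (hf_inv : ContDiff ℝ (⊤ : ℕ∞) f_inv)
    (hleft : Function.LeftInverse f_inv f) (y : Fin n → ℝ) :
    jacobian n f_inv (f y) * jacobian n f y = 1 := by
  ext i j
  rw [Matrix.mul_apply]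
  have hd : DifferentiableAt ℝ f_inv (f y) := (hf_inv.differentiable (by simp)) _
  have h2 : DifferentiableAt ℝ (fun z => f_inv z i) (f y) := differentiableAt_pi.1 hd i
  have h := lb_pd_comp (V := fun z => f_inv z i) j h2 ((hf.differentiable (by simp)) y)
  have h3 : ∀ k, pd n k (fun z => f_inv z i) (f y) = jacobian n f_inv (f y) i k := by
    intro k
    unfold pd jacobian
    rw [fderiv_apply hd]
    rfl
  simp only [h3] at h
  rw [← h]
  simp only [hleft _]
  unfold pd
  have h4 : (fun y : Fin n → ℝ => y i) =
    (ContinuousLinearMap.proj (R := ℝ) (φ := fun _ : Fin n => ℝ) i) := rfl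
  rw [h4, (ContinuousLinearMap.proj (R := ℝ) (φ := fun _ : Fin n => ℝ) i).hasFDerivAt.fderiv]
  simp [Matrix.one_apply, Pi.single_apply]

lemma lb_piola {n : ℕ} {J K : (Fin n → ℝ) → Matrix (Fin n) (Fin n) ℝ}
    (hJ : ∀ i j, Differentiable ℝ fun y => J y i j) (hK : ∀ i j, Differentiable ℝ fun y => K y i j)
    (hKJ : ∀ y, K y * J y = 1)
    (x : Fin n → ℝ)
    (hs : ∀ μ k l, pd n μ (fun y => J y k l) x = pd n l (fun y => J y k μ) x) (i : Fin n) :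
    ∑ μ, pd n μ (fun y => (J y).det * K y μ i) x = 0 := by
  have hadj : (J x).adjugate = (J x).det • K x := by
    have : (J x).adjugate * (J x * K x) = (J x).det • K x := by
      rw [← mul_assoc, Matrix.adjugate_mul, Matrix.smul_mul, one_mul]
    rwa [mul_eq_one_comm.1 (hKJ x), mul_one] at this
  have hdet : DifferentiableAt ℝ (fun y => (J y).det) x := by
    simp only [Matrix.det_apply']
    refine DifferentiableAt.fun_sum fun σ _ => (differentiableAt_const _).fun_mul
      (lb_prod fun i => hJ _ _ x)
  have hDK : ∀ μ, pd n μ (fun y => K y μ i) x =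
      - ∑ l, ∑ k, K x μ k * pd n μ (fun y => J y k l) x * K x l i := by
    intro μ
    let DK : Matrix (Fin n) (Fin n) ℝ := Matrix.of fun a b => pd n μ (fun y => K y a b) x
    let DJ : Matrix (Fin n) (Fin n) ℝ := Matrix.of fun a b => pd n μ (fun y => J y a b) x
    have h0 : DK * J x + K x * DJ = 0 := by
      ext a b
      rw [Matrix.add_apply, Matrix.mul_apply, Matrix.mul_apply, ← Finset.sum_add_distrib]
      have : pd n μ (fun y => ∑ k, K y a k * J y k b) x = 0 := by
        have : (fun y => ∑ k, K y a k * J y k b) = fun _ => (1 : Matrix (Fin n) (Fin n) ℝ) a b := by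
          funext y
          rw [← hKJ y, Matrix.mul_apply]
        rw [this]
        simp [pd]
      rw [lb_pd_sum μ _ (fun k => (hK _ _ x).fun_mul (hJ _ _ x))] at this
      rw [Matrix.zero_apply, ← this]
      refine Finset.sum_congr rfl fun k _ => ?_
      rw [lb_pd_mul μ (hK _ _ x) (hJ _ _ x)]
      rfl
    have h1 : DK = - (K x * DJ * K x) := by
      have h2 : (DK * J x + K x * DJ) * K x = 0 := by rw [h0, zero_mul]
      rw [add_mul, mul_assoc, mul_eq_one_comm.1 (hKJ x), mul_one] at h2
      exact eq_neg_of_add_eq_zero_left h2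
    have h3 := congrFun (congrFun h1 μ) i
    rw [Matrix.neg_apply, Matrix.mul_apply] at h3
    simp only [Matrix.mul_apply, Finset.sum_mul] at h3
    exact h3
  have hterm : ∀ μ, pd n μ (fun y => (J y).det * K y μ i) x =
      (J x).det * (∑ l, ∑ k, K x l k * pd n μ (fun y => J y k l) x * K x μ i) -
      (J x).det * ∑ l, ∑ k, K x μ k * pd n μ (fun y => J y k l) x * K x l i := by
    intro μ
    rw [lb_pd_mul μ hdet (hK _ _ x), lb_jacobi μ (fun i j => hJ i j x), hadj, hDK]
    simp only [Matrix.smul_apply, smul_eq_mul, Finset.mul_sum, Finset.sum_mul, mul_neg, mul_assoc]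
    ring
  simp only [hterm]
  rw [Finset.sum_sub_distrib, ← Finset.mul_sum, ← Finset.mul_sum, sub_eq_zero]
  congr 1
  rw [Finset.sum_comm]
  refine Finset.sum_congr rfl fun l _ => Finset.sum_congr rfl fun μ _ =>
    Finset.sum_congr rfl fun k _ => ?_
  rw [hs]

lemma lb_div {n : ℕ} {J K : (Fin n → ℝ) → Matrix (Fin n) (Fin n) ℝ}
    (hJ : ∀ i j, Differentiable ℝ fun y => J y i j) (hK : ∀ i j, Differentiable ℝ fun y => K y i j)
    (hKJ : ∀ y, K y * J y = 1) (hdet : Differentiable ℝ fun y => (J y).det)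
    (x : Fin n → ℝ)
    (hs : ∀ μ k l, pd n μ (fun y => J y k l) x = pd n l (fun y => J y k μ) x)
    (f : (Fin n → ℝ) → (Fin n → ℝ)) (hf : Differentiable ℝ f) (hJf : J x = jacobian n f x)
    (V : Fin n → (Fin n → ℝ) → ℝ) (hV : ∀ i, Differentiable ℝ (V i)) :
    ∑ μ, pd n μ (fun y => ∑ i, ((J y).det * K y μ i) * V i (f y)) x =
      (J x).det * ∑ i, pd n i (V i) (f x) := by
  have hVf : ∀ i, DifferentiableAt ℝ (fun y => V i (f y)) x := fun i => ((hV i).comp hf) x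
  have h1 : ∀ μ, pd n μ (fun y => ∑ i, ((J y).det * K y μ i) * V i (f y)) x =
      ∑ i, (pd n μ (fun y => (J y).det * K y μ i) x * V i (f x) +
        ∑ k, (J x).det * pd n k (V i) (f x) * (J x k μ * K x μ i)) := by
    intro μ
    rw [lb_pd_sum μ _ (fun i => ((hdet x).fun_mul (hK _ _ x)).fun_mul (hVf i))]
    refine Finset.sum_congr rfl fun i _ => ?_
    rw [lb_pd_mul μ ((hdet x).fun_mul (hK _ _ x)) (hVf i), lb_pd_comp μ (hV i _) (hf x), ← hJf,
      Finset.mul_sum]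
    congr 1
    refine Finset.sum_congr rfl fun k _ => ?_
    ring
  simp only [h1]
  rw [Finset.sum_comm, Finset.mul_sum]
  refine Finset.sum_congr rfl fun i _ => ?_
  rw [Finset.sum_add_distrib, ← Finset.sum_mul, lb_piola hJ hK hKJ x hs, zero_mul, zero_add,
    Finset.sum_comm]
  have h2 : ∀ k, ∑ μ, (J x).det * pd n k (V i) (f x) * (J x k μ * K x μ i) =
      (J x).det * pd n k (V i) (f x) * (1 : Matrix (Fin n) (Fin n) ℝ) k i := by
    intro k
    rw [← Finset.mul_sum, ← Matrix.mul_apply, mul_eq_one_comm.1 (hKJ x)]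
  simp only [h2, Matrix.one_apply]
  simp

/-- Density-valued equivariance of the free scalar BV differential:
`√(det (f*g)) · Δ_{f*g}(φ ∘ f) = |det Df| · (√(det g) · Δ_g φ) ∘ f`. -/
theorem laplace_beltrami_density_equivariant (n : ℕ)
    (g : (Fin n → ℝ) → Matrix (Fin n) (Fin n) ℝ)
    (hg : ∀ i j, ContDiff ℝ (⊤ : ℕ∞) fun x => g x i j)
    (hsymm : ∀ x, (g x).IsSymm) (hpos : ∀ x, (g x).PosDef)
    (f f_inv : (Fin n → ℝ) → (Fin n → ℝ))
    (hf : ContDiff ℝ (⊤ : ℕ∞) f) (hf_inv : ContDiff ℝ (⊤ : ℕ∞) f_inv)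
    (hleft : Function.LeftInverse f_inv f) (hright : Function.RightInverse f_inv f)
    (φ : (Fin n → ℝ) → ℝ) (hφ : ContDiff ℝ (⊤ : ℕ∞) φ) (x : Fin n → ℝ) :
    Real.sqrt (pullbackMet n f g x).det * lapBel n (pullbackMet n f g) (φ ∘ f) x =
      |(jacobian n f x).det| * Real.sqrt (g (f x)).det * lapBel n g φ (f x) := by
  have hJs := lb_jac_smooth hf
  have hK0 := lb_jac_smooth hf_inv
  have hfd : Differentiable ℝ f := hf.differentiable (by simp)
  obtain ⟨J, hJdef⟩ : ∃ J, J = jacobian n f := ⟨_, rfl⟩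
  obtain ⟨K, hKdef⟩ : ∃ K, K = fun y => jacobian n f_inv (f y) := ⟨_, rfl⟩
  have hJ : ∀ i j, Differentiable ℝ fun y => J y i j := fun i j => by
    rw [hJdef]; exact (hJs i j).differentiable (by simp)
  have hK : ∀ i j, Differentiable ℝ fun y => K y i j := fun i j => by
    rw [hKdef]; exact ((hK0 i j).comp hf).differentiable (by simp)
  have hKJ : ∀ y, K y * J y = 1 := fun y => by
    rw [hKdef, hJdef]; exact lb_inv hf hf_inv hleft y
  have hdet : Differentiable ℝ fun y => (J y).det := by
    rw [hJdef]; exact (lb_det_diff hJs).differentiable (by simp)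
  have hs : ∀ μ k l, pd n μ (fun y => J y k l) x = pd n l (fun y => J y k μ) x := by
    rw [hJdef]; exact fun μ k l => lb_symm hf μ k l x
  let V : Fin n → (Fin n → ℝ) → ℝ :=
    fun μ y => Real.sqrt (g y).det * ∑ ν, (g y)⁻¹ μ ν * pd n ν φ y
  have hgpos : ∀ y, 0 < (g y).det := fun y => (hpos y).det_pos
  have hgdet : ContDiff ℝ (⊤ : ℕ∞) fun y => (g y).det := lb_det_diff hg
  have hginv : ∀ i j, ContDiff ℝ (⊤ : ℕ∞) fun y => (g y)⁻¹ i j := by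
    intro i j
    have : (fun y => (g y)⁻¹ i j) = fun y => ((g y).det)⁻¹ * ((g y).updateRow j (Pi.single i 1)).det := by
      funext y
      rw [Matrix.inv_def, Matrix.smul_apply, Matrix.adjugate_apply, Ring.inverse_eq_inv', smul_eq_mul]
    rw [this]
    refine (hgdet.inv fun y => (hgpos y).ne').mul (lb_det_diff fun a b => ?_)
    by_cases h : a = j
    · subst h
      simp only [Matrix.updateRow_self]
      exact contDiff_const
    · simp only [Matrix.updateRow_ne h]
      exact hg a b
  have hV : ∀ i, Differentiable ℝ (V i) := by
    intro i
    have : ContDiff ℝ (⊤ : ℕ∞) (V i) := by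
      refine (hgdet.sqrt fun y => (hgpos y).ne').mul (ContDiff.sum fun ν _ => ?_)
      exact (hginv i ν).mul (lb_pd_smooth hφ ν)
    exact this.differentiable (by simp)
  have hdiv := lb_div hJ hK hKJ hdet x hs f hfd (by rw [hJdef]) V hV
  have hJ0 : ∀ y, (J y).det ≠ 0 := by
    intro y h
    have := congrArg Matrix.det (hKJ y)
    rw [Matrix.det_mul, h, mul_zero, Matrix.det_one] at this
    exact zero_ne_one this
  have hpdet : ∀ y, Real.sqrt (pullbackMet n f g y).det = |(J y).det| * Real.sqrt (g (f y)).det := by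
    intro y
    have : (pullbackMet n f g y).det = (J y).det ^ 2 * (g (f y)).det := by
      unfold pullbackMet
      rw [← hJdef, Matrix.det_mul, Matrix.det_mul, Matrix.det_transpose]
      ring
    rw [this, Real.sqrt_mul (sq_nonneg _), Real.sqrt_sq_eq_abs]
  have hpinv : ∀ y, (pullbackMet n f g y)⁻¹ = K y * (g (f y))⁻¹ * (K y)ᵀ := by
    intro y
    have hinv : (J y)⁻¹ = K y := Matrix.inv_eq_left_inv (hKJ y)
    unfold pullbackMet
    rw [← hJdef, Matrix.mul_inv_rev, Matrix.mul_inv_rev, ← Matrix.transpose_nonsing_inv, hinv,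
      mul_assoc]
  have hgrad : ∀ y ν, pd n ν (φ ∘ f) y = ∑ k, pd n k φ (f y) * J y k ν := by
    intro y ν
    rw [hJdef]
    exact lb_pd_comp ν ((hφ.differentiable (by simp)) _) (hfd y)
  have hW : ∀ μ y, Real.sqrt (pullbackMet n f g y).det *
      ∑ ν, (pullbackMet n f g y)⁻¹ μ ν * pd n ν (φ ∘ f) y =
      |(J y).det| * ∑ i, K y μ i * V i (f y) := by
    intro μ y
    let p : Fin n → ℝ := fun k => pd n k φ (f y)
    have e1 : (fun ν => pd n ν (φ ∘ f) y) = (J y)ᵀ *ᵥ p := by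
      funext ν
      rw [hgrad]
      simp only [Matrix.mulVec, dotProduct, Matrix.transpose_apply]
      exact Finset.sum_congr rfl fun k _ => mul_comm _ _
    have e2 : ∑ ν, (pullbackMet n f g y)⁻¹ μ ν * pd n ν (φ ∘ f) y =
        (K y *ᵥ ((g (f y))⁻¹ *ᵥ p)) μ := by
      have : ∑ ν, (pullbackMet n f g y)⁻¹ μ ν * pd n ν (φ ∘ f) y =
        ((pullbackMet n f g y)⁻¹ *ᵥ (fun ν => pd n ν (φ ∘ f) y)) μ := rfl
      rw [this, e1, hpinv, Matrix.mulVec_mulVec, Matrix.mulVec_mulVec, mul_assoc,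
        ← Matrix.transpose_mul, mul_eq_one_comm.1 (hKJ y), Matrix.transpose_one, mul_one]
    rw [e2, hpdet, mul_assoc]
    congr 1
    simp only [Matrix.mulVec, dotProduct, V, p]
    rw [Finset.mul_sum]
    refine Finset.sum_congr rfl fun i _ => ?_
    ring
  obtain ⟨s, hs1⟩ : ∃ s : ℝ, ∀ᶠ y in nhds x, |(J y).det| = s * (J y).det := by
    have hc : ContinuousAt (fun y => (J y).det) x := hdet.continuous.continuousAt
    rcases lt_or_gt_of_ne (hJ0 x) with h | h
    · refine ⟨-1, ?_⟩
      filter_upwards [hc.eventually_lt continuousAt_const h] with y hy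
      rw [abs_of_neg hy]; ring
    · refine ⟨1, ?_⟩
      filter_upwards [continuousAt_const.eventually_lt hc h] with y hy
      rw [abs_of_pos hy]; ring
  have hpd : ∀ μ, pd n μ (fun y => Real.sqrt (pullbackMet n f g y).det *
      ∑ ν, (pullbackMet n f g y)⁻¹ μ ν * pd n ν (φ ∘ f) y) x =
      s * pd n μ (fun y => ∑ i, ((J y).det * K y μ i) * V i (f y)) x := by
    intro μ
    have hdiff : DifferentiableAt ℝ (fun y => ∑ i, ((J y).det * K y μ i) * V i (f y)) x :=
      DifferentiableAt.fun_sum fun i _ => ((hdet x).fun_mul (hK _ _ x)).fun_mul (((hV i).comp hfd) x)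
    have hc : pd n μ (fun _ => s) x = 0 := by simp [pd]
    have := lb_pd_mul μ (differentiableAt_const s) hdiff
    rw [hc, zero_mul, zero_add] at this
    rw [← this]
    have heq : (fun y => Real.sqrt (pullbackMet n f g y).det *
      ∑ ν, (pullbackMet n f g y)⁻¹ μ ν * pd n ν (φ ∘ f) y) =ᶠ[nhds x]
      fun y => s * ∑ i, ((J y).det * K y μ i) * V i (f y) := by
      filter_upwards [hs1] with y hy
      rw [hW, hy, mul_assoc]
      simp only [Finset.mul_sum, mul_assoc]
    unfold pd at heq ⊢
    rw [heq.fderiv_eq]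
  have hn1 : Real.sqrt (pullbackMet n f g x).det ≠ 0 := by
    rw [hpdet]
    exact mul_ne_zero (abs_ne_zero.2 (hJ0 x)) (Real.sqrt_pos.2 (hgpos _)).ne'
  have hn2 : Real.sqrt (g (f x)).det ≠ 0 := (Real.sqrt_pos.2 (hgpos _)).ne'
  unfold lapBel
  rw [mul_inv_cancel_left₀ hn1, mul_assoc, mul_inv_cancel_left₀ hn2]
  simp only [hpd]
  rw [← Finset.mul_sum, hdiv, ← hJdef, hs1.self_of_nhds, mul_assoc]
end

section
/- Let g : ℝⁿ → Matrix (Fin n) (Fin n) ℝ be C^∞ with g(x) symmetric and positive definite for every x, let f : ℝⁿ → ℝⁿ be a C^∞ diffeomorphism, let φ : ℝⁿ → ℝ be C^∞, and let P : Polynomial ℝ be any real polynomial. Define the nonlinear Euler–Lagrange operator of scalar field theory with polynomial potential by E_g(φ)(x) := Δ_g φ(x) + P.eval(φ(x)). Then E_{f*g}(φ ∘ f)(x) = E_g(φ)(f(x)) for every x ∈ ℝⁿ. (Coordinate form of the Lemma: any diffeomorphism defines an L∞ map between fibers of the bundle of perturbative scalar BV theories with polynomial potential, i.e. the scalar field with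 polynomial potential is generally covariant.) -/
open Matrix

lemma pd_mul {n : ℕ} (μ : Fin n) {a b : (Fin n → ℝ) → ℝ} {x : Fin n → ℝ}
    (ha : DifferentiableAt ℝ a x) (hb : DifferentiableAt ℝ b x) :
    pd n μ (fun y => a y * b y) x = pd n μ a x * b x + a x * pd n μ b x := by
  unfold pd
  rw [fderiv_fun_mul ha hb]
  simp
  ring

lemma pd_sum {n : ℕ} (μ : Fin n) {a : Fin n → (Fin n → ℝ) → ℝ} {x : Fin n → ℝ}
    (ha : ∀ i, DifferentiableAt ℝ (a i) x) :
    pd n μ (fun y => ∑ i, a i y) x = ∑ i, pd n μ (a i) x := by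
  unfold pd
  rw [fderiv_fun_sum (fun i _ => ha i)]
  simp

lemma pd_comp {n : ℕ} (μ : Fin n) {W : (Fin n → ℝ) → ℝ} {f : (Fin n → ℝ) → (Fin n → ℝ)}
    {x : Fin n → ℝ} (hW : DifferentiableAt ℝ W (f x)) (hf : DifferentiableAt ℝ f x) :
    pd n μ (fun y => W (f y)) x = ∑ b, jacobian n f x b μ * pd n b W (f x) := by
  have h : fderiv ℝ (fun y => W (f y)) x = (fderiv ℝ W (f x)).comp (fderiv ℝ f x) :=
    fderiv_comp x hW hf
  unfold pd
  rw [h, ContinuousLinearMap.comp_apply]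
  conv_lhs => rw [pi_eq_sum_univ' (fderiv ℝ f x (Pi.single μ 1))]
  rw [map_sum]
  refine Finset.sum_congr rfl fun b _ => ?_
  rw [map_smul, smul_eq_mul]
  rfl

lemma contDiff_det {n : ℕ} {A : (Fin n → ℝ) → Matrix (Fin n) (Fin n) ℝ}
    (hA : ∀ i j, ContDiff ℝ (⊤ : ℕ∞) fun x => A x i j) :
    ContDiff ℝ (⊤ : ℕ∞) fun x => (A x).det := by
  simp only [Matrix.det_apply']
  refine ContDiff.sum fun σ _ => contDiff_const.mul ?_
  exact contDiff_prod fun i _ => hA _ _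

lemma contDiff_adj {n : ℕ} {A : (Fin n → ℝ) → Matrix (Fin n) (Fin n) ℝ}
    (hA : ∀ i j, ContDiff ℝ (⊤ : ℕ∞) fun x => A x i j) (i j : Fin n) :
    ContDiff ℝ (⊤ : ℕ∞) fun x => (A x).adjugate i j := by
  simp only [Matrix.adjugate_apply]
  refine contDiff_det fun k l => ?_
  by_cases h : k = j
  · subst h; simp only [Matrix.updateRow_self]; exact contDiff_const
  · simp only [Matrix.updateRow_ne h]; exact hA k l

lemma pd_det {n : ℕ} (μ : Fin n) {A : (Fin n → ℝ) → Matrix (Fin n) (Fin n) ℝ} {x : Fin n → ℝ}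
    (hA : ∀ i j, DifferentiableAt ℝ (fun y => A y i j) x) :
    pd n μ (fun y => (A y).det) x =
      ∑ i, ∑ j, (A x).adjugate j i * pd n μ (fun y => A y i j) x := by
  let D : ContinuousMultilinearMap ℝ (fun _ : Fin n => (Fin n → ℝ)) ℝ :=
    ⟨(Matrix.detRowAlternating (n := Fin n) (R := ℝ)).toMultilinearMap, by
      exact Continuous.matrix_det (A := fun M : Matrix (Fin n) (Fin n) ℝ => M) continuous_id⟩
  have hA' : HasFDerivAt (fun y => (fun i j => A y i j : Fin n → Fin n → ℝ))
      (ContinuousLinearMap.pi fun i => ContinuousLinearMap.pi fun j =>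
        fderiv ℝ (fun y => A y i j) x) x := by
    rw [hasFDerivAt_pi]
    intro i
    rw [hasFDerivAt_pi]
    intro j
    exact (hA i j).hasFDerivAt
  have h := (D.hasFDerivAt (x := fun i j => A x i j)).comp x hA'
  have h2 : HasFDerivAt (fun y => (A y).det) _ x := h
  unfold pd
  rw [h2.fderiv, ContinuousLinearMap.comp_apply, ContinuousMultilinearMap.linearDeriv_apply]
  refine Finset.sum_congr rfl fun i _ => ?_
  have : ∀ v : Fin n → ℝ, D (Function.update (fun i j => A x i j) i v)
      = ∑ j, (A x).adjugate j i * v j := by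
    intro v
    have h3 : D (Function.update (fun i j => A x i j) i v) = ((A x).updateRow i v).det := rfl
    rw [h3, ← Matrix.cramer_transpose_apply, Matrix.cramer_eq_adjugate_mulVec,
      ← Matrix.adjugate_transpose]
    rfl
  rw [this]
  rfl

lemma jac_contDiff {n : ℕ} {f : (Fin n → ℝ) → (Fin n → ℝ)} (hf : ContDiff ℝ (⊤ : ℕ∞) f)
    (i j : Fin n) : ContDiff ℝ (⊤ : ℕ∞) fun x => jacobian n f x i j := by
  have h1 : ContDiff ℝ (⊤ : ℕ∞) (fderiv ℝ f) := hf.fderiv_right (by simp)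
  have h2 := h1.clm_apply (contDiff_const (c := (Pi.single j 1 : Fin n → ℝ)))
  exact (contDiff_pi.1 h2) i

lemma jac_symm {n : ℕ} {f : (Fin n → ℝ) → (Fin n → ℝ)} (hf : ContDiff ℝ (⊤ : ℕ∞) f)
    (x : Fin n → ℝ) (i j k : Fin n) :
    pd n k (fun y => jacobian n f y i j) x = pd n j (fun y => jacobian n f y i k) x := by
  have h1 : ContDiff ℝ (⊤ : ℕ∞) (fderiv ℝ f) := hf.fderiv_right (by simp)
  have hd : DifferentiableAt ℝ (fderiv ℝ f) x := h1.differentiable (by simp) x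
  have key : ∀ j k, pd n k (fun y => jacobian n f y i j) x
      = fderiv ℝ (fderiv ℝ f) x (Pi.single k 1) (Pi.single j 1) i := by
    intro j k
    have e1 : HasFDerivAt (fun y => fderiv ℝ f y (Pi.single j 1)) _ x :=
      hd.hasFDerivAt.clm_apply (hasFDerivAt_const _ x)
    have e2 := (hasFDerivAt_pi'.1 e1) i
    have e3 : HasFDerivAt (fun y => jacobian n f y i j) _ x := e2
    unfold pd
    rw [e3.fderiv]
    simp
  rw [key, key]
  have hs : IsSymmSndFDerivAt ℝ f x :=
    hf.contDiffAt.isSymmSndFDerivAt (by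
      rw [minSmoothness_of_isRCLikeNormedField]
      exact WithTop.coe_le_coe.2 (le_top : (2 : ℕ∞) ≤ ⊤))
  rw [hs]

lemma piola {n : ℕ} {f : (Fin n → ℝ) → (Fin n → ℝ)} (hf : ContDiff ℝ (⊤ : ℕ∞) f)
    (x : Fin n → ℝ) (hdet : (jacobian n f x).det ≠ 0) (a : Fin n) :
    ∑ μ, pd n μ (fun y => (jacobian n f y).adjugate μ a) x = 0 := by
  have hJ := fun i j => (jac_contDiff hf i j).differentiable (by simp) x
  have hAdj := fun i j => (contDiff_adj (jac_contDiff hf) i j).differentiable (by simp) x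
  have hDet := (contDiff_det (jac_contDiff hf)).differentiable (by simp) x
  set J := jacobian n f x with hJdef
  let R := J⁻¹
  have hu : IsUnit J.det := isUnit_iff_ne_zero.2 hdet
  have hJR : J * R = 1 := Matrix.mul_nonsing_inv _ hu
  have hadj : J.adjugate = J.det • R := by
    have := Matrix.adjugate_mul J
    calc J.adjugate = J.adjugate * (J * R) := by rw [hJR, mul_one]
      _ = _ := by rw [← mul_assoc, this]; simp
  let dA : Fin n → Matrix (Fin n) (Fin n) ℝ := fun μ => Matrix.of fun i j =>
    pd n μ (fun y => (jacobian n f y).adjugate i j) x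
  let dJ : Fin n → Matrix (Fin n) (Fin n) ℝ := fun μ => Matrix.of fun i j =>
    pd n μ (fun y => jacobian n f y i j) x
  let dd : Fin n → ℝ := fun μ => pd n μ (fun y => (jacobian n f y).det) x
  have h1 : ∀ μ, dA μ * J + J.adjugate * dJ μ = dd μ • (1 : Matrix (Fin n) (Fin n) ℝ) := by
    intro μ
    ext i k
    have e : (fun y => ∑ j, (jacobian n f y).adjugate i j * jacobian n f y j k)
        = fun y => (jacobian n f y).det * (1 : Matrix (Fin n) (Fin n) ℝ) i k := by
      funext y
      rw [← Matrix.mul_apply, Matrix.adjugate_mul]; rfl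
    have e2 := congrArg (fun F => pd n μ F x) e
    beta_reduce at e2
    rw [pd_sum μ (fun j => (hAdj i j).fun_mul (hJ j k)), pd_mul μ hDet (by fun_prop)] at e2
    have e3 : pd n μ (fun _ => (1 : Matrix (Fin n) (Fin n) ℝ) i k) x = 0 := by simp [pd]
    rw [e3, mul_zero, add_zero] at e2
    rw [Finset.sum_congr rfl (fun j _ => pd_mul μ (hAdj i j) (hJ j k)),
      Finset.sum_add_distrib] at e2
    exact e2
  have h2 : ∀ μ, dA μ = dd μ • R - J.det • (R * dJ μ * R) := by
    intro μ
    have := congrArg (· * R) (h1 μ)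
    simp only [add_mul, mul_assoc, hJR, mul_one, hadj, smul_mul_assoc, one_mul] at this
    rw [← this, mul_assoc]; simp
  have h3 : ∀ μ, dd μ = J.det * ∑ i, ∑ j, R j i * dJ μ i j := by
    intro μ
    have e : dd μ = _ := pd_det μ hJ
    rw [e, ← hJdef, hadj, Finset.mul_sum]
    refine Finset.sum_congr rfl fun i _ => ?_
    rw [Finset.mul_sum]
    refine Finset.sum_congr rfl fun j _ => ?_
    simp only [Matrix.smul_apply, smul_eq_mul, mul_assoc]
    rfl
  have hsym : ∀ i j k, dJ k i j = dJ j i k := fun i j k => jac_symm hf x i j k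
  change ∑ μ, dA μ μ a = 0
  have h4 : ∀ μ, dA μ μ a = J.det * (∑ i, ∑ j, R j i * dJ μ i j * R μ a)
      - J.det * ∑ j, ∑ i, R μ i * dJ μ i j * R j a := by
    intro μ
    rw [h2, h3]
    simp only [Matrix.sub_apply, Matrix.smul_apply, smul_eq_mul, Matrix.mul_apply,
      Finset.sum_mul]
    simp only [mul_assoc, Finset.sum_mul]
  simp only [h4, Finset.sum_sub_distrib, ← Finset.mul_sum]
  rw [sub_eq_zero]
  congr 1
  calc ∑ μ, ∑ i, ∑ j, R j i * dJ μ i j * R μ a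
      = ∑ μ, ∑ j, ∑ i, R j i * dJ μ i j * R μ a :=
        Finset.sum_congr rfl fun μ _ => Finset.sum_comm
    _ = ∑ j, ∑ μ, ∑ i, R j i * dJ μ i j * R μ a := Finset.sum_comm
    _ = _ := by
      refine Finset.sum_congr rfl fun j _ => Finset.sum_congr rfl fun μ _ =>
        Finset.sum_congr rfl fun i _ => ?_
      rw [hsym i j μ]

lemma pd_congr {n : ℕ} (μ : Fin n) {a b : (Fin n → ℝ) → ℝ} {x : Fin n → ℝ}
    (h : a =ᶠ[nhds x] b) : pd n μ a x = pd n μ b x := by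
  unfold pd; rw [h.fderiv_eq]

lemma jac_det_ne {n : ℕ} {f f_inv : (Fin n → ℝ) → (Fin n → ℝ)}
    (hf : ContDiff ℝ (⊤ : ℕ∞) f) (hf_inv : ContDiff ℝ (⊤ : ℕ∞) f_inv)
    (hleft : Function.LeftInverse f_inv f) (x : Fin n → ℝ) : (jacobian n f x).det ≠ 0 := by
  have h : jacobian n f_inv (f x) * jacobian n f x = 1 := by
    ext i j
    have e := pd_comp (n := n) j (W := fun z => f_inv z i) (f := f) (x := x)
      ((differentiableAt_pi.1 (hf_inv.differentiable (by simp) (f x))) i)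
      (hf.differentiable (by simp) x)
    have e0 : (fun y => f_inv (f y) i) = fun y : Fin n → ℝ => y i := by
      funext y; rw [hleft y]
    have e1 : pd n j (fun y : Fin n → ℝ => y i) x = (1 : Matrix (Fin n) (Fin n) ℝ) i j := by
      unfold pd
      have := (ContinuousLinearMap.proj (R := ℝ) (φ := fun _ : Fin n => ℝ) i).hasFDerivAt (x := x)
      have h' : HasFDerivAt (fun y : Fin n → ℝ => y i) _ x := this
      rw [h'.fderiv]
      simp [Matrix.one_apply, Pi.single_apply]
    rw [e0, e1] at e
    rw [e, Matrix.mul_apply]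
    refine Finset.sum_congr rfl fun b _ => ?_
    rw [mul_comm]
    congr 1
    have := (hasFDerivAt_pi'.1 (hf_inv.differentiable (by simp) (f x)).hasFDerivAt) i
    unfold pd
    rw [this.fderiv]
    rfl
  intro h0
  have := congrArg Matrix.det h
  rw [Matrix.det_mul, h0] at this
  simp at this

lemma div_pull {n : ℕ} {f : (Fin n → ℝ) → (Fin n → ℝ)} (hf : ContDiff ℝ (⊤ : ℕ∞) f)
    (x : Fin n → ℝ) (hdet : (jacobian n f x).det ≠ 0) (W : Fin n → (Fin n → ℝ) → ℝ)
    (hW : ∀ a, DifferentiableAt ℝ (W a) (f x)) (s : ℝ) :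
    ∑ μ, pd n μ (fun y => s * ∑ a, (jacobian n f y).adjugate μ a * W a (f y)) x
      = s * (jacobian n f x).det * ∑ a, pd n a (W a) (f x) := by
  have hfd := hf.differentiable (by simp) x
  have hAdj := fun i j => (contDiff_adj (jac_contDiff hf) i j).differentiable (by simp) x
  have hWf : ∀ a, DifferentiableAt ℝ (fun y => W a (f y)) x := fun a => (hW a).comp x hfd
  have h1 : ∀ μ, pd n μ (fun y => s * ∑ a, (jacobian n f y).adjugate μ a * W a (f y)) x
      = s * ∑ a, (pd n μ (fun y => (jacobian n f y).adjugate μ a) x * W a (f x)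
        + (jacobian n f x).adjugate μ a * ∑ b, jacobian n f x b μ * pd n b (W a) (f x)) := by
    intro μ
    have hs : DifferentiableAt ℝ (fun y => ∑ a, (jacobian n f y).adjugate μ a * W a (f y)) x :=
      DifferentiableAt.fun_sum fun a _ => (hAdj μ a).fun_mul (hWf a)
    rw [pd_mul μ (a := fun _ => s) (differentiableAt_const _) hs]
    have e3 : pd n μ (fun _ => s) x = 0 := by simp [pd]
    rw [e3, zero_mul, zero_add, pd_sum μ (fun a => (hAdj μ a).fun_mul (hWf a))]
    congr 1
    refine Finset.sum_congr rfl fun a _ => ?_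
    rw [pd_mul μ (hAdj μ a) (hWf a), pd_comp μ (hW a) hfd]
  simp only [h1, ← Finset.mul_sum]
  rw [mul_assoc]
  congr 1
  simp only [Finset.sum_add_distrib]
  rw [Finset.sum_comm]
  simp only [← Finset.sum_mul, piola hf x hdet, zero_mul, Finset.sum_const_zero, zero_add]
  rw [Finset.sum_comm, Finset.mul_sum]
  refine Finset.sum_congr rfl fun a _ => ?_
  simp only [Finset.mul_sum]
  rw [Finset.sum_comm]
  have h2 : ∀ b, ∑ μ, (jacobian n f x).adjugate μ a * (jacobian n f x b μ * pd n b (W a) (f x))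
      = ((jacobian n f x).det • (1 : Matrix (Fin n) (Fin n) ℝ)) b a * pd n b (W a) (f x) := by
    intro b
    rw [← Matrix.mul_adjugate, Matrix.mul_apply, Finset.sum_mul]
    refine Finset.sum_congr rfl fun μ _ => by ring
  simp only [h2]
  simp [Matrix.one_apply]

lemma inner_id {n : ℕ} (G J : Matrix (Fin n) (Fin n) ℝ) (hJ : J.det ≠ 0)
    (p : Fin n → ℝ) (s : ℝ) (hs : |J.det| = s * J.det) (μ : Fin n) :
    Real.sqrt (Jᵀ * G * J).det * ∑ ν, (Jᵀ * G * J)⁻¹ μ ν * ∑ b, J b ν * p b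
      = s * ∑ a, J.adjugate μ a * (Real.sqrt G.det * ∑ ν, G⁻¹ a ν * p ν) := by
  have hu : IsUnit J.det := isUnit_iff_ne_zero.2 hJ
  have hut : IsUnit Jᵀ.det := by rwa [Matrix.det_transpose]
  have h1 : Real.sqrt (Jᵀ * G * J).det = |J.det| * Real.sqrt G.det := by
    rw [Matrix.det_mul, Matrix.det_mul, Matrix.det_transpose,
      show J.det * G.det * J.det = J.det ^ 2 * G.det by ring,
      Real.sqrt_mul (sq_nonneg _), Real.sqrt_sq_eq_abs]
  have hadj : J.adjugate = J.det • J⁻¹ := by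
    calc J.adjugate = J.adjugate * (J * J⁻¹) := by rw [Matrix.mul_nonsing_inv _ hu, mul_one]
      _ = _ := by rw [← mul_assoc, Matrix.adjugate_mul]; simp
  have h2 : ∑ ν, (Jᵀ * G * J)⁻¹ μ ν * ∑ b, J b ν * p b
      = ∑ a, J⁻¹ μ a * ∑ ν, G⁻¹ a ν * p ν := by
    change ((Jᵀ * G * J)⁻¹ *ᵥ (Jᵀ *ᵥ p)) μ = (J⁻¹ *ᵥ (G⁻¹ *ᵥ p)) μ
    rw [Matrix.mulVec_mulVec, Matrix.mulVec_mulVec, Matrix.mul_inv_rev, Matrix.mul_inv_rev,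
      mul_assoc, mul_assoc, Matrix.nonsing_inv_mul _ hut, mul_one]
  rw [h1, h2, hs, hadj, Finset.mul_sum, Finset.mul_sum]
  refine Finset.sum_congr rfl fun a _ => ?_
  simp only [Matrix.smul_apply, smul_eq_mul]
  ring

lemma lapBel_pull {n : ℕ}
    (g : (Fin n → ℝ) → Matrix (Fin n) (Fin n) ℝ)
    (hg : ∀ i j, ContDiff ℝ (⊤ : ℕ∞) fun x => g x i j)
    (hpos : ∀ x, (g x).PosDef)
    (f : (Fin n → ℝ) → (Fin n → ℝ))
    (hf : ContDiff ℝ (⊤ : ℕ∞) f) (hdet : ∀ x, (jacobian n f x).det ≠ 0)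
    (φ : (Fin n → ℝ) → ℝ) (hφ : ContDiff ℝ (⊤ : ℕ∞) φ) (x : Fin n → ℝ) :
    lapBel n (pullbackMet n f g) (φ ∘ f) x = lapBel n g φ (f x) := by
  have hgd : ∀ z, 0 < (g z).det := fun z => (hpos z).det_pos
  have hpd : ∀ ν, ContDiff ℝ (⊤ : ℕ∞) (pd n ν φ) := fun ν =>
    (hφ.fderiv_right (m := (⊤ : ℕ∞)) (by simp)).clm_apply contDiff_const
  let W : Fin n → (Fin n → ℝ) → ℝ := fun a z =>
    Real.sqrt (g z).det * ∑ ν, (g z)⁻¹ a ν * pd n ν φ z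
  have hW : ∀ a, DifferentiableAt ℝ (W a) (f x) := by
    intro a
    have hD := (contDiff_det hg).differentiable (by simp) (f x)
    refine (hD.sqrt (hgd _).ne').mul (DifferentiableAt.fun_sum fun ν _ => ?_)
    refine DifferentiableAt.mul ?_ ((hpd ν).differentiable (by simp) (f x))
    have e : (fun z => (g z)⁻¹ a ν) = fun z => ((g z).det)⁻¹ * (g z).adjugate a ν := by
      funext z
      rw [Matrix.inv_def, Ring.inverse_eq_inv']; rfl
    rw [e]
    exact (hD.inv (hgd _).ne').mul ((contDiff_adj hg a ν).differentiable (by simp) (f x))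
  obtain ⟨s, hs⟩ : ∃ s : ℝ, ∀ᶠ y in nhds x,
      |(jacobian n f y).det| = s * (jacobian n f y).det := by
    have hc : ContinuousAt (fun y => (jacobian n f y).det) x :=
      (contDiff_det (jac_contDiff hf)).continuous.continuousAt
    rcases lt_or_gt_of_ne (hdet x) with h | h
    · refine ⟨-1, (hc.eventually (gt_mem_nhds h)).mono fun y hy => ?_⟩
      rw [abs_of_neg hy]; ring
    · refine ⟨1, (hc.eventually (lt_mem_nhds h)).mono fun y hy => ?_⟩
      rw [abs_of_pos hy]; ring
  have hV : ∀ μ, (fun y => Real.sqrt (pullbackMet n f g y).det *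
        ∑ ν, (pullbackMet n f g y)⁻¹ μ ν * pd n ν (φ ∘ f) y) =ᶠ[nhds x]
      fun y => s * ∑ a, (jacobian n f y).adjugate μ a * W a (f y) := by
    intro μ
    refine hs.mono fun y hy => ?_
    have e : ∀ ν, pd n ν (φ ∘ f) y = ∑ b, jacobian n f y b ν * pd n b φ (f y) := fun ν =>
      pd_comp ν (hφ.differentiable (by simp) _) (hf.differentiable (by simp) _)
    simp only [e]
    exact inner_id (g (f y)) (jacobian n f y) (hdet y) (fun b => pd n b φ (f y)) s hy μ
  unfold lapBel
  rw [Finset.sum_congr rfl fun μ _ => pd_congr μ (hV μ), div_pull hf x (hdet x) W hW s,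
    ← hs.self_of_nhds]
  have h1 : Real.sqrt (pullbackMet n f g x).det
      = |(jacobian n f x).det| * Real.sqrt (g (f x)).det := by
    unfold pullbackMet
    rw [Matrix.det_mul, Matrix.det_mul, Matrix.det_transpose,
      show ∀ a b : ℝ, a * b * a = a ^ 2 * b by intros; ring,
      Real.sqrt_mul (sq_nonneg _), Real.sqrt_sq_eq_abs]
  have h2 : |(jacobian n f x).det| ≠ 0 := abs_ne_zero.2 (hdet x)
  rw [h1, mul_inv, mul_comm (|(jacobian n f x).det|)⁻¹, mul_assoc, ← mul_assoc _ _ (∑ a, _),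
    inv_mul_cancel₀ h2, one_mul]

/-- The nonlinear Euler–Lagrange operator `E_g(φ) = Δ_g φ + P(φ)` of scalar field theory
with polynomial potential is diffeomorphism-equivariant:
`E_{f*g}(φ ∘ f) = (E_g φ) ∘ f`. -/
theorem euler_lagrange_polynomial_equivariant (n : ℕ)
    (g : (Fin n → ℝ) → Matrix (Fin n) (Fin n) ℝ)
    (hg : ∀ i j, ContDiff ℝ (⊤ : ℕ∞) fun x => g x i j)
    (hsymm : ∀ x, (g x).IsSymm) (hpos : ∀ x, (g x).PosDef)
    (f f_inv : (Fin n → ℝ) → (Fin n → ℝ))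
    (hf : ContDiff ℝ (⊤ : ℕ∞) f) (hf_inv : ContDiff ℝ (⊤ : ℕ∞) f_inv)
    (hleft : Function.LeftInverse f_inv f) (hright : Function.RightInverse f_inv f)
    (φ : (Fin n → ℝ) → ℝ) (hφ : ContDiff ℝ (⊤ : ℕ∞) φ) (P : Polynomial ℝ) (x : Fin n → ℝ) :
    lapBel n (pullbackMet n f g) (φ ∘ f) x + P.eval ((φ ∘ f) x) =
      lapBel n g φ (f x) + P.eval (φ (f x)) := by
  rw [lapBel_pull g hg hpos f hf (jac_det_ne hf hf_inv hleft) φ hφ x]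
  rfl
end

section
/- Let g : ℝⁿ → Matrix (Fin n) (Fin n) ℝ be C^∞ with g(x) symmetric and positive definite for every x, let f : ℝⁿ → ℝⁿ be a C^∞ diffeomorphism, and let φ : ℝⁿ → ℝ be C^∞ with compact support. Then the scalar field action functional is diffeomorphism invariant: ∫_{ℝⁿ} (φ ∘ f)(x) · Δ_{f*g}(φ ∘ f)(x) · √(det((f*g)(x))) dx = ∫_{ℝⁿ} φ(y) · Δ_g φ(y) · √(det g(y)) dy. (The coordinate statement that S_{f*g}(f*φ) = S_g(φ) for the scalar action S_g(φ) = -(1/2)∫ φ Δ_g φ vol_g, i.e. general covariance of the action functional.) -/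
open Matrix

open MeasureTheory

lemma contDiff_det_aux {n : ℕ} (M : (Fin n → ℝ) → Matrix (Fin n) (Fin n) ℝ)
    (hM : ∀ i j, ContDiff ℝ (⊤ : ℕ∞) fun x => M x i j) :
    ContDiff ℝ (⊤ : ℕ∞) fun x => (M x).det := by
  simp only [Matrix.det_apply']
  refine ContDiff.sum fun σ _ => contDiff_const.mul ?_
  exact contDiff_prod fun i _ => hM _ _

lemma contDiff_inv_aux {n : ℕ} (M : (Fin n → ℝ) → Matrix (Fin n) (Fin n) ℝ)
    (hM : ∀ i j, ContDiff ℝ (⊤ : ℕ∞) fun x => M x i j) (hd : ∀ x, 0 < (M x).det) (i j : Fin n) :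
    ContDiff ℝ (⊤ : ℕ∞) fun x => (M x)⁻¹ i j := by
  have : (fun x => (M x)⁻¹ i j) =
      fun x => ((M x).det)⁻¹ * ((M x).updateRow j (Pi.single i 1)).det := by
    funext x
    rw [Matrix.inv_def, Matrix.smul_apply, Matrix.adjugate_apply, Ring.inverse_eq_inv, smul_eq_mul]
  rw [this]
  refine ((contDiff_det_aux M hM).inv fun x => (hd x).ne').mul (contDiff_det_aux _ fun a b => ?_)
  by_cases h : a = j
  · subst h
    simp only [Matrix.updateRow_self]
    exact contDiff_const
  · simp only [Matrix.updateRow_ne h]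
    exact hM a b

lemma contDiff_pd_aux {n : ℕ} (ψ : (Fin n → ℝ) → ℝ) (hψ : ContDiff ℝ (⊤ : ℕ∞) ψ) (μ : Fin n) :
    ContDiff ℝ (⊤ : ℕ∞) (pd n μ ψ) := by
  unfold pd
  exact (hψ.fderiv_right (m := (⊤ : ℕ∞)) (by simp)).clm_apply contDiff_const

lemma action_weak_aux {n : ℕ} (h : (Fin n → ℝ) → Matrix (Fin n) (Fin n) ℝ)
    (hh : ∀ i j, ContDiff ℝ (⊤ : ℕ∞) fun x => h x i j) (hd : ∀ x, 0 < (h x).det)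
    (ψ : (Fin n → ℝ) → ℝ) (hψ : ContDiff ℝ (⊤ : ℕ∞) ψ) (hs : HasCompactSupport ψ) :
    ∫ x, ψ x * lapBel n h ψ x * Real.sqrt (h x).det =
      -∫ x, Real.sqrt (h x).det *
        ((fun μ => pd n μ ψ x) ⬝ᵥ ((h x)⁻¹ *ᵥ (fun μ => pd n μ ψ x))) := by
  set V : Fin n → (Fin n → ℝ) → ℝ :=
    fun μ y => Real.sqrt (h y).det * ∑ ν, (h y)⁻¹ μ ν * pd n ν ψ y with hV
  have hVs : ∀ μ, ContDiff ℝ (⊤ : ℕ∞) (V μ) := fun μ =>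
    ((contDiff_det_aux h hh).sqrt fun x => (hd x).ne').mul
      (ContDiff.sum fun ν _ => (contDiff_inv_aux h hh hd μ ν).mul (contDiff_pd_aux ψ hψ ν))
  have hsp : ∀ μ, HasCompactSupport (pd n μ ψ) := fun μ => hs.fderiv_apply (𝕜 := ℝ) _
  have i1 : ∀ μ, Integrable (fun x => pd n μ ψ x * V μ x) := fun μ =>
    ((contDiff_pd_aux ψ hψ μ).continuous.mul (hVs μ).continuous).integrable_of_hasCompactSupport
      (hsp μ).mul_right
  have i2 : ∀ μ, Integrable (fun x => ψ x * pd n μ (V μ) x) := fun μ =>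
    (hψ.continuous.mul (contDiff_pd_aux _ (hVs μ) μ).continuous).integrable_of_hasCompactSupport
      hs.mul_right
  have i3 : ∀ μ, Integrable (fun x => ψ x * V μ x) := fun μ =>
    (hψ.continuous.mul (hVs μ).continuous).integrable_of_hasCompactSupport hs.mul_right
  have e1 : ∀ x, ψ x * lapBel n h ψ x * Real.sqrt (h x).det = ∑ μ, ψ x * pd n μ (V μ) x := by
    intro x
    have : Real.sqrt (h x).det ≠ 0 := (Real.sqrt_pos.2 (hd x)).ne'
    rw [← Finset.mul_sum]
    unfold lapBel
    field_simp
    rfl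
  have e2 : ∀ x, Real.sqrt (h x).det *
        ((fun μ => pd n μ ψ x) ⬝ᵥ ((h x)⁻¹ *ᵥ (fun μ => pd n μ ψ x))) =
      ∑ μ, pd n μ ψ x * V μ x := by
    intro x
    simp only [dotProduct, Matrix.mulVec, hV]
    rw [Finset.mul_sum]
    refine Finset.sum_congr rfl fun μ _ => ?_
    ring
  simp_rw [e1, e2]
  rw [integral_finsetSum _ fun μ _ => i2 μ, integral_finsetSum _ fun μ _ => i1 μ,
    ← Finset.sum_neg_distrib]
  refine Finset.sum_congr rfl fun μ _ => ?_
  exact integral_mul_fderiv_eq_neg_fderiv_mul_of_integrable (i1 μ) (i2 μ) (i3 μ)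
    (fun x _ => (hψ.differentiable (by simp)) x) (fun x _ => ((hVs μ).differentiable (by simp)) x)

lemma jacobian_eq_aux {n : ℕ} (f : (Fin n → ℝ) → (Fin n → ℝ)) (x : Fin n → ℝ) :
    jacobian n f x = LinearMap.toMatrix' (fderiv ℝ f x : (Fin n → ℝ) →ₗ[ℝ] (Fin n → ℝ)) := by
  ext i j
  rfl

lemma jacobian_det_aux {n : ℕ} (f : (Fin n → ℝ) → (Fin n → ℝ)) (x : Fin n → ℝ) :
    (jacobian n f x).det = (fderiv ℝ f x).det := by
  rw [jacobian_eq_aux, LinearMap.det_toMatrix']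

lemma jacobian_det_ne_aux {n : ℕ} (f f_inv : (Fin n → ℝ) → (Fin n → ℝ))
    (hf : ContDiff ℝ (⊤ : ℕ∞) f) (hf_inv : ContDiff ℝ (⊤ : ℕ∞) f_inv)
    (hleft : Function.LeftInverse f_inv f) (x : Fin n → ℝ) : (jacobian n f x).det ≠ 0 := by
  have h1 : HasFDerivAt (f_inv ∘ f) ((fderiv ℝ f_inv (f x)).comp (fderiv ℝ f x)) x :=
    ((hf_inv.differentiable (by simp)) (f x)).hasFDerivAt.comp x
      ((hf.differentiable (by simp)) x).hasFDerivAt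
  rw [hleft.comp_eq_id] at h1
  have h2 := h1.unique (hasFDerivAt_id x)
  have h3 : LinearMap.det (fderiv ℝ f_inv (f x) : (Fin n → ℝ) →ₗ[ℝ] (Fin n → ℝ)) *
      LinearMap.det (fderiv ℝ f x : (Fin n → ℝ) →ₗ[ℝ] (Fin n → ℝ)) = 1 := by
    rw [← LinearMap.det_comp, ← ContinuousLinearMap.toLinearMap_comp, h2]
    exact LinearMap.det_id
  rw [jacobian_eq_aux, LinearMap.det_toMatrix']
  exact right_ne_zero_of_mul_eq_one h3

lemma pd_comp_aux {n : ℕ} (f : (Fin n → ℝ) → (Fin n → ℝ)) (hf : ContDiff ℝ (⊤ : ℕ∞) f)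
    (φ : (Fin n → ℝ) → ℝ) (hφ : ContDiff ℝ (⊤ : ℕ∞) φ) (x : Fin n → ℝ) :
    (fun μ => pd n μ (φ ∘ f) x) = (jacobian n f x)ᵀ *ᵥ (fun μ => pd n μ φ (f x)) := by
  funext μ
  have h1 : fderiv ℝ (φ ∘ f) x = (fderiv ℝ φ (f x)).comp (fderiv ℝ f x) :=
    fderiv_comp x ((hφ.differentiable (by simp)) _) ((hf.differentiable (by simp)) x)
  simp only [pd, h1, ContinuousLinearMap.comp_apply, Matrix.mulVec, dotProduct,
    Matrix.transpose_apply, jacobian, Matrix.of_apply]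
  conv_lhs => rw [pi_eq_sum_univ' (fderiv ℝ f x (Pi.single μ 1))]
  simp [map_sum, smul_eq_mul]

lemma quad_aux {n : ℕ} (J G : Matrix (Fin n) (Fin n) ℝ) (hJ : J.det ≠ 0) (v : Fin n → ℝ) :
    (Jᵀ *ᵥ v) ⬝ᵥ ((Jᵀ * G * J)⁻¹ *ᵥ (Jᵀ *ᵥ v)) = v ⬝ᵥ (G⁻¹ *ᵥ v) := by
  have hu : IsUnit J.det := isUnit_iff_ne_zero.2 hJ
  have hu' : IsUnit Jᵀ.det := by rwa [Matrix.det_transpose]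
  have : J * ((Jᵀ * G * J)⁻¹ * Jᵀ) = G⁻¹ := by
    rw [Matrix.mul_inv_rev, Matrix.mul_inv_rev, Matrix.mul_assoc, Matrix.mul_assoc,
      Matrix.nonsing_inv_mul _ hu', Matrix.mul_one, ← Matrix.mul_assoc, Matrix.mul_nonsing_inv _ hu,
      Matrix.one_mul]
  rw [Matrix.mulVec_mulVec, Matrix.mulVec_transpose, ← Matrix.dotProduct_mulVec,
    Matrix.mulVec_mulVec, this]

/-- Diffeomorphism invariance of the scalar field action functional:
`∫ (φ∘f) Δ_{f*g}(φ∘f) √det(f*g) = ∫ φ Δ_g φ √det g`. -/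
theorem scalar_action_diffeomorphism_invariant (n : ℕ)
    (g : (Fin n → ℝ) → Matrix (Fin n) (Fin n) ℝ)
    (hg : ∀ i j, ContDiff ℝ (⊤ : ℕ∞) fun x => g x i j)
    (hsymm : ∀ x, (g x).IsSymm) (hpos : ∀ x, (g x).PosDef)
    (f f_inv : (Fin n → ℝ) → (Fin n → ℝ))
    (hf : ContDiff ℝ (⊤ : ℕ∞) f) (hf_inv : ContDiff ℝ (⊤ : ℕ∞) f_inv)
    (hleft : Function.LeftInverse f_inv f) (hright : Function.RightInverse f_inv f)
    (φ : (Fin n → ℝ) → ℝ) (hφ : ContDiff ℝ (⊤ : ℕ∞) φ) (hsupp : HasCompactSupport φ) :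
    ∫ x, (φ ∘ f) x * lapBel n (pullbackMet n f g) (φ ∘ f) x *
        Real.sqrt (pullbackMet n f g x).det =
      ∫ y, φ y * lapBel n g φ y * Real.sqrt (g y).det := by
  have hgd : ∀ x, 0 < (g x).det := fun x => (hpos x).det_pos
  have hJ : ∀ x, (jacobian n f x).det ≠ 0 := jacobian_det_ne_aux f f_inv hf hf_inv hleft
  have hdet : ∀ x, (pullbackMet n f g x).det = (jacobian n f x).det ^ 2 * (g (f x)).det := by
    intro x
    simp only [pullbackMet, Matrix.det_mul, Matrix.det_transpose]
    ring
  have hpd : ∀ x, 0 < (pullbackMet n f g x).det := by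
    intro x
    rw [hdet]
    exact mul_pos (by have := hJ x; positivity) (hgd _)
  have hJs : ∀ i j, ContDiff ℝ (⊤ : ℕ∞) fun x => jacobian n f x i j := by
    intro i j
    have := (hf.fderiv_right (m := (⊤ : ℕ∞)) (by simp)).clm_apply
      (contDiff_const (c := (Pi.single j 1 : Fin n → ℝ)))
    exact contDiff_pi.1 this i
  have hps : ∀ i j, ContDiff ℝ (⊤ : ℕ∞) fun x => pullbackMet n f g x i j := by
    intro i j
    simp only [pullbackMet, Matrix.mul_apply, Matrix.transpose_apply]
    exact ContDiff.sum fun a _ => (ContDiff.sum fun b _ =>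
      (hJs _ _).mul ((hg _ _).comp hf)).mul (hJs _ _)
  let F : (Fin n → ℝ) ≃ₜ (Fin n → ℝ) :=
    { toFun := f, invFun := f_inv, left_inv := hleft, right_inv := hright,
      continuous_toFun := hf.continuous, continuous_invFun := hf_inv.continuous }
  have hcs : HasCompactSupport (φ ∘ f) := hsupp.comp_isClosedEmbedding F.isClosedEmbedding
  rw [action_weak_aux _ hps hpd _ (hφ.comp hf) hcs, action_weak_aux g hg hgd φ hφ hsupp]
  congr 1
  have hcv := integral_image_eq_integral_abs_det_fderiv_smul (volume : Measure (Fin n → ℝ))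
    MeasurableSet.univ (f := f) (f' := fderiv ℝ f)
    (fun x _ => ((hf.differentiable (by simp)) x).hasFDerivAt.hasFDerivWithinAt)
    hleft.injective.injOn
    (fun y => Real.sqrt (g y).det *
        ((fun μ => pd n μ φ y) ⬝ᵥ ((g y)⁻¹ *ᵥ (fun μ => pd n μ φ y))))
  rw [Set.image_univ, hright.surjective.range_eq] at hcv
  simp only [Measure.restrict_univ] at hcv
  rw [hcv]
  congr 1
  funext x
  rw [pd_comp_aux f hf φ hφ x, hdet, Real.sqrt_mul (sq_nonneg _), Real.sqrt_sq_eq_abs,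
    jacobian_det_aux, smul_eq_mul, mul_assoc]
  unfold pullbackMet
  rw [quad_aux _ _ (hJ x)]
end

section
/- Let g : ℝ × ℝⁿ → Matrix (Fin n) (Fin n) ℝ be C^∞ with g(t,x) symmetric and positive definite for all (t,x). Write g_t := g(t,·), write h(x) for the t-derivative of t ↦ g(t,x) at t = 0, set k(x) := −(g_0(x))⁻¹ * h(x) * (g_0(x))⁻¹, and let φ : ℝⁿ → ℝ be C^∞. Then for every x ∈ ℝⁿ the function t ↦ Δ_{g_t}φ(x) is differentiable at t = 0 with derivative equal to −(1/2) · trace((g_0(x))⁻¹ * h(x)) · Δ_{g_0}φ(x) + (det g_0(x))^(-1/2) · ∑_μ ∂_μ( y ↦ (det g_0(y))^(1/2) · ( (1/2) · trace((g_0(y))⁻¹ * h(y)) · ∑_ν ((g_0(y))⁻¹) μ ν · ∂_ν φ(y) + ∑_ν (k(y)) μ ν · ∂_ν φ(y) ) )(x). (Lemma: the first order deformation of the Laplace–Beltrami operator with respect to the metric.) -/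
open Matrix

theorem aux_contDiff_det {E : Type*} [NormedAddCommGroup E] [NormedSpace ℝ E] {n : ℕ}
    (A : E → Matrix (Fin n) (Fin n) ℝ) (hA : ∀ i j, ContDiff ℝ (⊤ : ℕ∞) fun p => A p i j) :
    ContDiff ℝ (⊤ : ℕ∞) fun p => (A p).det := by
  simp only [Matrix.det_apply']
  refine ContDiff.sum fun σ _ => contDiff_const.mul ?_
  exact contDiff_prod fun i _ => hA _ _

theorem aux_contDiff_inv {E : Type*} [NormedAddCommGroup E] [NormedSpace ℝ E] {n : ℕ}
    (A : E → Matrix (Fin n) (Fin n) ℝ) (hA : ∀ i j, ContDiff ℝ (⊤ : ℕ∞) fun p => A p i j)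
    (hd : ∀ p, (A p).det ≠ 0) (i j : Fin n) :
    ContDiff ℝ (⊤ : ℕ∞) fun p => (A p)⁻¹ i j := by
  simp only [Matrix.inv_def, Matrix.smul_apply, Ring.inverse_eq_inv', smul_eq_mul,
    Matrix.adjugate_apply]
  refine ((aux_contDiff_det A hA).inv hd).mul (aux_contDiff_det _ fun k l => ?_)
  by_cases hk : k = j
  · subst hk
    simpa using contDiff_const
  · simpa [Matrix.updateRow_apply, hk] using hA k l

theorem aux_deriv_det {n : ℕ} (A : ℝ → Matrix (Fin n) (Fin n) ℝ) (A' : Matrix (Fin n) (Fin n) ℝ)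
    (t : ℝ) (hA : ∀ i j, HasDerivAt (fun s => A s i j) (A' i j) t) :
    HasDerivAt (fun s => (A s).det) (Matrix.trace ((A t).adjugate * A')) t := by
  have h1 : HasDerivAt (fun s => (A s).det)
      (∑ σ : Equiv.Perm (Fin n), ((Equiv.Perm.sign σ : ℤ) : ℝ) *
        ∑ i, (∏ j ∈ Finset.univ.erase i, A t (σ j) j) • A' (σ i) i) t := by
    simp only [Matrix.det_apply']
    refine HasDerivAt.fun_sum fun σ _ => HasDerivAt.const_mul _ ?_
    exact HasDerivAt.fun_finsetProd fun i _ => hA _ _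
  convert h1 using 1
  simp only [Finset.mul_sum]
  rw [Finset.sum_comm, Matrix.trace]
  refine Finset.sum_congr rfl fun i _ => ?_
  have h2 : ((A t).adjugate * A').diag i = ((A t).updateCol i (fun k => A' k i)).det := by
    rw [← Matrix.cramer_apply, Matrix.cramer_eq_adjugate_mulVec]
    rfl
  rw [h2, Matrix.det_apply']
  refine Finset.sum_congr rfl fun σ _ => ?_
  rw [← Finset.mul_prod_erase _ _ (Finset.mem_univ i)]
  simp only [Matrix.updateCol_self, smul_eq_mul]
  rw [mul_comm (A' _ _)]
  congr 2
  refine Finset.prod_congr rfl fun j hj => ?_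
  rw [Matrix.updateCol_ne (Finset.ne_of_mem_erase hj)]

theorem aux_deriv_sqrt {n : ℕ} (A : ℝ → Matrix (Fin n) (Fin n) ℝ) (A' : Matrix (Fin n) (Fin n) ℝ)
    (t : ℝ) (hA : ∀ i j, HasDerivAt (fun s => A s i j) (A' i j) t) (hd : 0 < (A t).det) :
    HasDerivAt (fun s => Real.sqrt (A s).det)
      (Real.sqrt (A t).det * ((1/2) * Matrix.trace ((A t)⁻¹ * A'))) t := by
  convert (aux_deriv_det A A' t hA).sqrt hd.ne' using 1
  have h3 : (A t).adjugate = (A t).det • (A t)⁻¹ := by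
    rw [Matrix.inv_def, smul_smul, Ring.inverse_eq_inv', mul_inv_cancel₀ hd.ne', one_smul]
  rw [h3, Matrix.smul_mul, Matrix.trace_smul, smul_eq_mul]
  have h4 := Real.sqrt_pos.2 hd
  have h5 := Real.mul_self_sqrt hd.le
  field_simp
  rw [pow_two, h5, mul_comm]

theorem aux_deriv_inv {n : ℕ} (A : ℝ → Matrix (Fin n) (Fin n) ℝ) (A' : Matrix (Fin n) (Fin n) ℝ)
    (t : ℝ) (hA : ∀ i j, HasDerivAt (fun s => A s i j) (A' i j) t) (hd : ∀ s, (A s).det ≠ 0)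
    (hi : ∀ i j, DifferentiableAt ℝ (fun s => (A s)⁻¹ i j) t) (i j : Fin n) :
    HasDerivAt (fun s => (A s)⁻¹ i j) ((-((A t)⁻¹ * A' * (A t)⁻¹)) i j) t := by
  let B' : Matrix (Fin n) (Fin n) ℝ := Matrix.of fun i j => deriv (fun s => (A s)⁻¹ i j) t
  have hB : ∀ i j, HasDerivAt (fun s => (A s)⁻¹ i j) (B' i j) t := fun i j => (hi i j).hasDerivAt
  have hu : ∀ s, IsUnit (A s).det := fun s => (hd s).isUnit
  have key : A' * (A t)⁻¹ + A t * B' = 0 := by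
    ext k l
    have h1 : HasDerivAt (fun s => (A s * (A s)⁻¹) k l) ((A' * (A t)⁻¹ + A t * B') k l) t := by
      simp only [Matrix.mul_apply, Matrix.add_apply, ← Finset.sum_add_distrib]
      exact HasDerivAt.fun_sum fun m _ => (hA k m).mul (hB m l)
    have h2 : (fun s => (A s * (A s)⁻¹) k l) = fun _ => (1 : Matrix (Fin n) (Fin n) ℝ) k l := by
      funext s
      rw [Matrix.mul_nonsing_inv _ (hu s)]
    rw [h2] at h1
    exact h1.unique (hasDerivAt_const _ _)
  have hB' : B' = -((A t)⁻¹ * A' * (A t)⁻¹) := by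
    have h1 : (A t)⁻¹ * (A' * (A t)⁻¹ + A t * B') = 0 := by rw [key, Matrix.mul_zero]
    rw [Matrix.mul_add, ← Matrix.mul_assoc, ← Matrix.mul_assoc, Matrix.nonsing_inv_mul _ (hu t),
      Matrix.one_mul] at h1
    exact eq_neg_of_add_eq_zero_right h1
  rw [← hB']
  exact hB i j

theorem aux_swap (n : ℕ) (μ : Fin n) (F : ℝ × (Fin n → ℝ) → ℝ) (hF : ContDiff ℝ (⊤ : ℕ∞) F)
    (F' : (Fin n → ℝ) → ℝ) (hF' : ∀ y, HasDerivAt (fun t => F (t, y)) (F' y) 0)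
    (x : Fin n → ℝ) :
    HasDerivAt (fun t => pd n μ (fun y => F (t, y)) x) (pd n μ F' x) 0 := by
  have hd : Differentiable ℝ F := hF.differentiable (by simp)
  have hF1 : ContDiff ℝ (⊤ : ℕ∞) (fderiv ℝ F) := hF.fderiv_right (by simp)
  have hd1 : Differentiable ℝ (fderiv ℝ F) := hF1.differentiable (by simp)
  have hy : ∀ t y, HasFDerivAt (fun y : Fin n → ℝ => ((t, y) : ℝ × (Fin n → ℝ)))
      (ContinuousLinearMap.inr ℝ ℝ (Fin n → ℝ)) y := fun t y => hasFDerivAt_prodMk_right t y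
  have ht : ∀ (t : ℝ) y, HasDerivAt (fun t : ℝ => ((t, y) : ℝ × (Fin n → ℝ))) (1, 0) t :=
    fun t y => (hasDerivAt_id t).prodMk (hasDerivAt_const t y)
  have e1 : (fun t => pd n μ (fun y => F (t, y)) x) =
      fun t => fderiv ℝ F (t, x) (0, Pi.single μ 1) := by
    funext t
    have := ((hd (t, x)).hasFDerivAt.comp x (hy t x)).fderiv
    unfold pd
    change fderiv ℝ (F ∘ fun y => (t, y)) x _ = _
    rw [this]
    simp
  have e2 : F' = fun y => fderiv ℝ F (0, y) (1, 0) := by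
    funext y
    exact (hF' y).unique ((hd (0, y)).hasFDerivAt.comp_hasDerivAt (0:ℝ) (ht 0 y))
  have hsym : IsSymmSndFDerivAt ℝ F (0, x) :=
    hF.contDiffAt.isSymmSndFDerivAt (by simpa using WithTop.coe_le_coe.2 (le_top : (2 : ℕ∞) ≤ ⊤))
  have e3 : pd n μ F' x = fderiv ℝ (fderiv ℝ F) (0, x) (1, 0) (0, Pi.single μ 1) := by
    rw [hsym.eq, e2]
    have h1 : HasFDerivAt (fun y => fderiv ℝ F (0, y)) _ x :=
      (hd1 (0, x)).hasFDerivAt.comp x (hy 0 x)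
    have h2 := (h1.clm_apply (hasFDerivAt_const ((1 : ℝ), (0 : Fin n → ℝ)) x)).fderiv
    unfold pd
    rw [h2]
    simp
  rw [e1, e3]
  have h1 : HasDerivAt (fun t => fderiv ℝ F (t, x)) (fderiv ℝ (fderiv ℝ F) (0, x) (1, 0)) 0 :=
    (hd1 (0, x)).hasFDerivAt.comp_hasDerivAt (0:ℝ) (ht 0 x)
  simpa using h1.clm_apply (hasDerivAt_const (0:ℝ) ((0 : ℝ), (Pi.single μ 1 : Fin n → ℝ)))

/-- First order deformation of the Laplace–Beltrami operator with respect to the metric: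
for a smooth family `g_t` with `∂_t g_t |_{t=0} = h` and `k = -g₀⁻¹ h g₀⁻¹`,
`d/dt Δ_{g_t}φ(x) |_{t=0} = -(1/2)·tr(g₀⁻¹h)·Δ_{g₀}φ(x)
  + (det g₀)^{-1/2} ∑_μ ∂_μ( √(det g₀) ((1/2)tr(g₀⁻¹h) ∑_ν g₀⁻¹ μ ν ∂_ν φ + ∑_ν k μ ν ∂_ν φ) )`. -/
theorem laplace_beltrami_first_order_deformation (n : ℕ)
    (g : ℝ × (Fin n → ℝ) → Matrix (Fin n) (Fin n) ℝ)
    (hg : ∀ i j, ContDiff ℝ (⊤ : ℕ∞) fun p => g p i j)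
    (hsymm : ∀ p, (g p).IsSymm) (hpos : ∀ p, (g p).PosDef)
    (h : (Fin n → ℝ) → Matrix (Fin n) (Fin n) ℝ)
    (hh : ∀ x i j, HasDerivAt (fun t => g (t, x) i j) (h x i j) 0)
    (φ : (Fin n → ℝ) → ℝ) (hφ : ContDiff ℝ (⊤ : ℕ∞) φ) (x : Fin n → ℝ) :
    HasDerivAt (fun t => lapBel n (fun y => g (t, y)) φ x)
      (-(1/2) * Matrix.trace ((g (0, x))⁻¹ * h x) * lapBel n (fun y => g (0, y)) φ x +
        (Real.sqrt (g (0, x)).det)⁻¹ *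
          ∑ μ, pd n μ (fun y =>
            Real.sqrt (g (0, y)).det *
              ((1/2) * Matrix.trace ((g (0, y))⁻¹ * h y) *
                  ∑ ν, (g (0, y))⁻¹ μ ν * pd n ν φ y +
                ∑ ν, (-((g (0, y))⁻¹ * h y * (g (0, y))⁻¹)) μ ν * pd n ν φ y)) x)
      0 := by
  have hdet : ∀ p, 0 < (g p).det := fun p => (hpos p).det_pos
  have hinv := aux_contDiff_inv g hg fun p => (hdet p).ne'
  have hsq : ContDiff ℝ (⊤ : ℕ∞) fun p => Real.sqrt (g p).det :=
    (aux_contDiff_det g hg).sqrt fun p => (hdet p).ne'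
  have hdsq := fun y => aux_deriv_sqrt (fun t => g (t, y)) (h y) 0 (hh y) (hdet (0, y))
  have hdinv := fun y => aux_deriv_inv (fun t => g (t, y)) (h y) 0 (hh y)
    (fun s => (hdet (s, y)).ne') (fun i j => by
      have h1 : Differentiable ℝ fun p => (g p)⁻¹ i j := (hinv i j).differentiable (by simp)
      exact (h1 (0, y)).comp (0 : ℝ) (f := fun t : ℝ => (t, y)) (by fun_prop))
  have hpd : ∀ ν, ContDiff ℝ (⊤ : ℕ∞) fun p : ℝ × (Fin n → ℝ) => pd n ν φ p.2 := by
    intro ν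
    have h1 : ContDiff ℝ (⊤ : ℕ∞) (fderiv ℝ φ) := hφ.fderiv_right (by simp)
    exact (h1.comp contDiff_snd).clm_apply contDiff_const
  have hmain : ∀ μ, HasDerivAt (fun t => pd n μ (fun y => Real.sqrt (g (t, y)).det *
      ∑ ν, (g (t, y))⁻¹ μ ν * pd n ν φ y) x) (pd n μ (fun y =>
            Real.sqrt (g (0, y)).det *
              ((1/2) * Matrix.trace ((g (0, y))⁻¹ * h y) *
                  ∑ ν, (g (0, y))⁻¹ μ ν * pd n ν φ y +
                ∑ ν, (-((g (0, y))⁻¹ * h y * (g (0, y))⁻¹)) μ ν * pd n ν φ y)) x) 0 := by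
    intro μ
    refine aux_swap n μ (fun p => Real.sqrt (g p).det * ∑ ν, (g p)⁻¹ μ ν * pd n ν φ p.2)
      (hsq.mul (ContDiff.sum fun ν _ => (hinv μ ν).mul (hpd ν))) _ (fun y => ?_) x
    have h1 := (hdsq y).mul (HasDerivAt.fun_sum (u := Finset.univ)
      fun ν _ => (hdinv y μ ν).mul_const (pd n ν φ y))
    refine h1.congr_deriv ?_
    ring
  have hs0 := Real.sqrt_pos.2 (hdet (0, x))
  have h2 := ((hdsq x).inv hs0.ne').mul (HasDerivAt.fun_sum (u := Finset.univ) fun μ _ => hmain μ)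
  refine h2.congr_deriv ?_
  simp only [lapBel, Pi.inv_apply]
  congr 1
  field_simp
end
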